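/- arXiv:2108.00463 — 2 statements merged into one kernel-verified Lean document; each statement's English description precedes it below -/
import Mathlib

section
/- Let n ≥ 1 and N be natural numbers with N ≥ 2n − 1, and let (a_i, b_i), i = 1,…,n, be a non-resonant n-chord diagram. Then the linear functionals p ↦ p(b_i) − p(a_i), i = 1,…,n, are linearly independent on P^N; equivalently, the subspace {p ∈ P^N : p(a_i) = p(b_i) for all i = 1,…,n} has dimension exactly N − n (codimension exactly n in P^N). -/
/-- The linear functional `f ↦ f b - f a` on the space `C(ℝ, ℝ)` of continuous
functions `ℝ → ℝ`. -/
noncomputable def evalDiff (a b : ℝ) : C(ℝ, ℝ) →ₗ[ℝ] ℝ where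
  toFun f := f b - f a
  map_add' f g := by simp; ring
  map_smul' c f := by simp [mul_sub]

/-- `P^N`: the `N`-dimensional space of real polynomials of degree at most `N`
with zero constant term. -/
noncomputable def Pspace (N : ℕ) : Submodule ℝ (Polynomial ℝ) :=
  Polynomial.degreeLE ℝ (N : ℕ) ⊓ LinearMap.ker (Polynomial.lcoeff ℝ 0)

/-- The common kernel inside `V` of finitely many functionals that are linearly independent on `V`
has codimension equal to their number. -/
theorem card_add_finrank_inf_iInf_ker {K M ι : Type*} [Field K] [AddCommGroup M] [Module K M]
    [Fintype ι] (V : Submodule K M) [FiniteDimensional K V] (φ : ι → M →ₗ[K] K)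
    (h : LinearIndependent K (fun i => (φ i).domRestrict V)) :
    Fintype.card ι + Module.finrank K ↥(V ⊓ ⨅ i, LinearMap.ker (φ i)) = Module.finrank K V := by
  rw [← Subspace.finrank_add_finrank_dualCoannihilator_eq
    (Submodule.span K (Set.range fun i => (φ i).domRestrict V)),
    finrank_span_eq_card h, ← Submodule.map_comap_subtype, Submodule.finrank_map_subtype_eq]
  have hker : (⨅ i, LinearMap.ker (φ i)).comap V.subtype =
      (Submodule.span K (Set.range fun i => (φ i).domRestrict V)).dualCoannihilator := by
    apply SetLike.coe_injective
    rw [Submodule.coe_dualCoannihilator_span]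
    ext x
    simp
  rw [hker]

instance finiteDimensional_degreeLE (N : ℕ) :
    FiniteDimensional ℝ (Polynomial.degreeLE ℝ (N : ℕ)) := by
  rw [← Polynomial.degreeLT_succ_eq_degreeLE]
  exact (Polynomial.degreeLTEquiv ℝ (N + 1)).symm.finiteDimensional

instance finiteDimensional_Pspace (N : ℕ) : FiniteDimensional ℝ (Pspace N) :=
  Submodule.finiteDimensional_inf_left _ _

theorem finrank_Pspace (N : ℕ) : Module.finrank ℝ (Pspace N) = N := by
  have h := card_add_finrank_inf_iInf_ker (Polynomial.degreeLE ℝ (N : ℕ))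
    (fun _ : Unit => Polynomial.lcoeff ℝ 0) <| by
      rw [linearIndependent_unique_iff]
      intro h0
      have h1 : (1 : Polynomial ℝ) ∈ Polynomial.degreeLE ℝ (N : ℕ) := by
        rw [Polynomial.mem_degreeLE, Polynomial.degree_one]
        exact_mod_cast N.zero_le
      simpa using LinearMap.congr_fun h0 ⟨1, h1⟩
  rw [ciInf_const, ← Polynomial.degreeLT_succ_eq_degreeLE,
    (Polynomial.degreeLTEquiv ℝ (N + 1)).finrank_eq, Module.finrank_fin_fun,
    Polynomial.degreeLT_succ_eq_degreeLE] at h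
  rw [Fintype.card_unit, add_comm] at h
  exact Nat.succ_injective h

/-- A function on `ℝ` agrees on any `N + 1` points, up to an additive constant, with an element of
`Pspace N`. -/
theorem exists_mem_Pspace_eval_sub_eval (N : ℕ) (s : Finset ℝ) (hs : s.card ≤ N + 1) (f : ℝ → ℝ) :
    ∃ p ∈ Pspace N, ∀ x ∈ s, ∀ y ∈ s, p.eval y - p.eval x = f y - f x := by
  set q := Lagrange.interpolate s id f
  have hinj : Set.InjOn (id : ℝ → ℝ) s := Function.injective_id.injOn
  have heval : ∀ x ∈ s, q.eval x = f x := fun x hx =>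
    Lagrange.eval_interpolate_at_node f hinj hx
  have hdeg : q ∈ Polynomial.degreeLE ℝ (N : ℕ) := by
    rw [← Polynomial.degreeLT_succ_eq_degreeLE, Polynomial.mem_degreeLT]
    exact (Lagrange.degree_interpolate_lt f hinj).trans_le (by exact_mod_cast hs)
  have hconst : Polynomial.C (q.coeff 0) ∈ Polynomial.degreeLE ℝ (N : ℕ) := by
    rw [Polynomial.mem_degreeLE]
    exact Polynomial.degree_C_le.trans (by exact_mod_cast N.zero_le)
  refine ⟨q - Polynomial.C (q.coeff 0), ⟨sub_mem hdeg hconst, by simp⟩, fun x hx y hy => ?_⟩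
  simp [heval x hx, heval y hy]

/-- If `N ≥ 2n - 1` and `(a_i, b_i)` is a non-resonant `n`-chord diagram, then the
functionals `p ↦ p (b i) - p (a i)` are linearly independent on `P^N`, and the
subspace of `P^N` cut out by the conditions `p (a i) = p (b i)` has dimension
exactly `N - n`. -/
theorem stmt0 (n N : ℕ) (hn : 1 ≤ n) (hN : 2 * n - 1 ≤ N)
    (a b : Fin n → ℝ) (hab : ∀ i, a i < b i)
    (hdist : Function.Injective (fun i => (a i, b i)))
    (hnonres : LinearIndependent ℝ (fun i => evalDiff (a i) (b i))) :
    LinearIndependent ℝ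
      (fun i => (Polynomial.leval (b i) - Polynomial.leval (a i)).domRestrict (Pspace N)) ∧
    Module.finrank ℝ
      ↥(Pspace N ⊓ ⨅ i, LinearMap.ker (Polynomial.leval (b i) - Polynomial.leval (a i)))
      = N - n := by
  classical
  have hli : LinearIndependent ℝ
      (fun i => (Polynomial.leval (b i) - Polynomial.leval (a i)).domRestrict (Pspace N)) := by
    rw [Fintype.linearIndependent_iff] at hnonres ⊢
    intro c hc
    refine hnonres c (LinearMap.ext fun f => ?_)
    have hcard : (Finset.univ.image a ∪ Finset.univ.image b).card ≤ N + 1 := by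
      have h₁ := Finset.card_union_le (Finset.univ.image a) (Finset.univ.image b)
      have h₂ := Finset.card_image_le (s := Finset.univ) (f := a)
      have h₃ := Finset.card_image_le (s := Finset.univ) (f := b)
      rw [Finset.card_fin] at h₂ h₃
      omega
    obtain ⟨p, hp, hpf⟩ := exists_mem_Pspace_eval_sub_eval N _ hcard f
    have hrel := LinearMap.congr_fun hc ⟨p, hp⟩
    have hval (i : Fin n) : p.eval (b i) - p.eval (a i) = f (b i) - f (a i) :=
      hpf _ (by simp) _ (by simp)
    simpa [evalDiff, LinearMap.sum_apply, Polynomial.leval_apply, hval] using hrel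
  refine ⟨hli, ?_⟩
  have h := card_add_finrank_inf_iInf_ker (Pspace N) _ hli
  rw [finrank_Pspace, Fintype.card_fin] at h
  omega
end

section
/- Let n ≥ 1 and N be natural numbers with N < 2n − I(n), where I(n) is the number of ones in the binary expansion of n. Then for every N-dimensional vector subspace F of C(ℝ,ℝ) there exists a non-resonant n-chord diagram (a_i, b_i), i = 1,…,n, such that the subspace {f ∈ F : f(a_i) = f(b_i) for all i = 1,…,n} has dimension strictly greater than N − n. -/
namespace ChordChains

open MvPolynomial

/-- Simplicial chains modulo two on the vertex set `V`; a monomial is a simplex. -/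
abbrev Chains (V : Type*) := MvPolynomial V (ZMod 2)

section Basic

variable {V W : Type*}

/-- The simplex with the given vertices. -/
noncomputable def simplex (s : Multiset V) : Chains V := (s.map X).prod

/-- The simplicial boundary, a derivation; the boundary of a vertex is the empty simplex. -/
noncomputable def bd : Derivation (ZMod 2) (Chains V) (Chains V) :=
  mkDerivation (ZMod 2) fun _ => 1

@[simp] lemma simplex_zero : simplex (0 : Multiset V) = 1 := by simp [simplex]

@[simp] lemma simplex_cons (v : V) (s : Multiset V) :
    simplex (v ::ₘ s) = X v * simplex s := by simp [simplex]

lemma simplex_add (s t : Multiset V) : simplex (s + t) = simplex s * simplex t := by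
  simp [simplex]

@[simp] lemma bd_X (v : V) : bd (X v : Chains V) = 1 := by simp [bd]

@[simp] lemma bd_one : bd (1 : Chains V) = 0 := Derivation.map_one_eq_zero _

lemma bd_mul (p q : Chains V) : bd (p * q) = bd p * q + p * bd q := by
  rw [Derivation.leibniz]; simp only [smul_eq_mul]; ring

lemma bd_X_mul (v : V) (p : Chains V) : bd (X v * p) = p + X v * bd p := by
  rw [bd_mul]; simp

lemma rename_simplex (f : V → W) (s : Multiset V) :
    rename f (simplex s) = simplex (s.map f) := by
  simp [simplex, map_multiset_prod, Multiset.map_map]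

lemma simplex_eq_monomial [DecidableEq V] (s : Multiset V) :
    simplex s = monomial (Multiset.toFinsupp s) (1 : ZMod 2) := by
  induction s using Multiset.induction_on with
  | empty => simp
  | cons v s ih =>
    rw [simplex_cons, ih, ← Multiset.singleton_add, Multiset.toFinsupp_add,
      Multiset.toFinsupp_singleton, X, monomial_mul, one_mul]

/-- The linear map on chains with prescribed values on simplices. -/
noncomputable def extend {M : Type*} [AddCommGroup M] [Module (ZMod 2) M] (f : Multiset V → M) :
    Chains V →ₗ[ZMod 2] M :=
  (basisMonomials V (ZMod 2)).constr (ZMod 2) fun m => f (Finsupp.toMultiset m)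

@[simp] lemma extend_simplex {M : Type*} [AddCommGroup M] [Module (ZMod 2) M]
    (f : Multiset V → M) (s : Multiset V) : extend f (simplex s) = f s := by
  classical
  have := (basisMonomials V (ZMod 2)).constr_basis (ZMod 2)
    (fun m => f (Finsupp.toMultiset m)) (Multiset.toFinsupp s)
  simpa [extend, simplex_eq_monomial] using this

/-- The chains supported on a set of simplices. -/
noncomputable def chainsOn (S : Set (Multiset V)) : Submodule (ZMod 2) (Chains V) :=
  Submodule.span (ZMod 2) (simplex '' S)

lemma simplex_mem {S : Set (Multiset V)} {s : Multiset V} (hs : s ∈ S) :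
    simplex s ∈ chainsOn S := Submodule.subset_span ⟨s, hs, rfl⟩

lemma mem_chainsOn_univ (p : Chains V) : p ∈ chainsOn (Set.univ : Set (Multiset V)) := by
  induction p using MvPolynomial.induction_on' with
  | monomial m a =>
    classical
    have : monomial m a = a • simplex (Finsupp.toMultiset m) := by
      rw [simplex_eq_monomial]; simp [smul_monomial]
    rw [this]
    exact Submodule.smul_mem _ _ (simplex_mem trivial)
  | add p q hp hq => exact Submodule.add_mem _ hp hq

/-- A linear statement about supported chains may be checked on simplices. -/
lemma map_mem_of_simplex {M : Type*} [AddCommGroup M] [Module (ZMod 2) M]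
    {S : Set (Multiset V)} {N : Submodule (ZMod 2) M} (f : Chains V →ₗ[ZMod 2] M)
    (h : ∀ s ∈ S, f (simplex s) ∈ N) {p : Chains V} (hp : p ∈ chainsOn S) : f p ∈ N := by
  have : chainsOn S ≤ N.comap f := by
    rw [chainsOn, Submodule.span_le]
    rintro _ ⟨s, hs, rfl⟩
    exact h s hs
  exact this hp

lemma eq_of_simplex {M : Type*} [AddCommGroup M] [Module (ZMod 2) M]
    {S : Set (Multiset V)} (f g : Chains V →ₗ[ZMod 2] M)
    (h : ∀ s ∈ S, f (simplex s) = g (simplex s)) {p : Chains V} (hp : p ∈ chainsOn S) :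
    f p = g p := by
  have := map_mem_of_simplex (N := ⊥) (f - g) (fun s hs => by simp [h s hs]) hp
  simpa [sub_eq_zero] using this

lemma chain_ext {M : Type*} [AddCommGroup M] [Module (ZMod 2) M] (f g : Chains V →ₗ[ZMod 2] M)
    (h : ∀ s, f (simplex s) = g (simplex s)) (p : Chains V) : f p = g p :=
  eq_of_simplex f g (fun s _ => h s) (mem_chainsOn_univ p)

lemma chainsOn_mono {S T : Set (Multiset V)} (h : S ⊆ T) : chainsOn S ≤ chainsOn T :=
  Submodule.span_mono (Set.image_mono h)

lemma rename_mem {S : Set (Multiset V)} {T : Set (Multiset W)} (f : V → W)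
    (h : ∀ s ∈ S, s.map f ∈ T) {p : Chains V} (hp : p ∈ chainsOn S) :
    rename f p ∈ chainsOn T :=
  map_mem_of_simplex (rename f : Chains V →ₐ[ZMod 2] Chains W).toLinearMap
    (fun s hs => by simpa [rename_simplex] using simplex_mem (h s hs)) hp

lemma mul_mem_chainsOn {S T U : Set (Multiset V)} (h : ∀ s ∈ S, ∀ t ∈ T, s + t ∈ U)
    {p q : Chains V} (hp : p ∈ chainsOn S) (hq : q ∈ chainsOn T) : p * q ∈ chainsOn U := by
  refine map_mem_of_simplex (LinearMap.mulRight (ZMod 2) q) (fun s hs => ?_) hp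
  refine map_mem_of_simplex (LinearMap.mulLeft (ZMod 2) (simplex s)) (fun t ht => ?_) hq
  simpa [← simplex_add] using simplex_mem (h s hs t ht)

lemma bd_simplex [DecidableEq V] (s : Multiset V) :
    bd (simplex s) = (s.map fun v => simplex (s.erase v)).sum := by
  induction s using Multiset.induction_on with
  | empty => simp
  | cons a s ih =>
    rw [simplex_cons, bd_X_mul, ih, Multiset.map_cons, Multiset.sum_cons,
      Multiset.erase_cons_head, ← Multiset.sum_map_mul_left]
    congr 2
    refine Multiset.map_congr rfl fun v hv => ?_
    rw [Multiset.erase_cons_tail_of_mem hv, simplex_cons]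

lemma add_self_chain (p : Chains V) : p + p = 0 := CharTwo.add_self_eq_zero p

lemma bd_bd (p : Chains V) : bd (bd p) = 0 := by
  refine chain_ext
    ((bd : Derivation (ZMod 2) (Chains V) (Chains V)).toLinearMap ∘ₗ
      (bd : Derivation (ZMod 2) (Chains V) (Chains V)).toLinearMap) 0 (fun s => ?_) p
  change bd (bd (simplex s)) = 0
  induction s using Multiset.induction_on with
  | empty => simp
  | cons a s ih => rw [simplex_cons, bd_X_mul, map_add, bd_X_mul, ih, mul_zero, add_zero,
      add_self_chain]

lemma bd_rename (f : V → W) (p : Chains V) : bd (rename f p) = rename f (bd p) := by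
  refine chain_ext
    ((bd : Derivation (ZMod 2) (Chains W) (Chains W)).toLinearMap ∘ₗ
      (rename f : Chains V →ₐ[ZMod 2] Chains W).toLinearMap)
    ((rename f : Chains V →ₐ[ZMod 2] Chains W).toLinearMap ∘ₗ
      (bd : Derivation (ZMod 2) (Chains V) (Chains V)).toLinearMap) (fun s => ?_) p
  change bd (rename f (simplex s)) = rename f (bd (simplex s))
  induction s using Multiset.induction_on with
  | empty => simp
  | cons a s ih => simp only [simplex_cons, map_mul, rename_X, bd_X_mul, ih, map_add]

end Basic

section Cone

variable {V W : Type*} (b : Multiset V → W) (θ : Chains V →ₗ[ZMod 2] Chains W) (c : Chains W)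

open Classical in
/-- The recursion on simplices defining `cone`. -/
noncomputable def coneAux : ℕ → Multiset V → Chains W
  | 0, _ => c
  | n + 1, s => X (b s) * (θ (simplex s) + (s.map fun v => coneAux n (s.erase v)).sum)

/-- The linear map defined by coning recursively off the vertices `b s`. For `θ = 0` this gives
subdivisions, for `θ = φ + ψ` chain homotopies between `φ` and `ψ`. -/
noncomputable def cone : Chains V →ₗ[ZMod 2] Chains W :=
  extend fun s => coneAux b θ c s.card s

@[simp] lemma cone_one : cone b θ c 1 = c := by
  rw [← simplex_zero, cone, extend_simplex]; rfl

lemma cone_simplex {s : Multiset V} (hs : s ≠ 0) :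
    cone b θ c (simplex s) = X (b s) * (θ (simplex s) + cone b θ c (bd (simplex s))) := by
  classical
  obtain ⟨n, hn⟩ : ∃ n, s.card = n + 1 :=
    Nat.exists_eq_succ_of_ne_zero (by simpa using hs)
  rw [bd_simplex, map_multiset_sum, Multiset.map_map, cone, extend_simplex, hn, coneAux]
  congr 3
  refine Multiset.map_congr rfl fun v hv => ?_
  have : (s.erase v).card = n := by rw [Multiset.card_erase_of_mem hv, hn]; rfl
  simp only [Function.comp, extend_simplex, this]

lemma simplex_induction {P : Multiset V → Prop} (h : ∀ s, (∀ t, t.card < s.card → P t) → P s)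
    (s : Multiset V) : P s := by
  induction hn : s.card using Nat.strong_induction_on generalizing s with
  | _ n ih => exact h s fun t ht => ih _ (hn ▸ ht) t rfl

lemma bd_cone (hθ : ∀ p, bd (θ p) = θ (bd p)) (hc : bd c = θ 1) (p : Chains V) :
    bd (cone b θ c p) = θ p + cone b θ c (bd p) := by
  classical
  refine chain_ext
    ((bd : Derivation (ZMod 2) (Chains W) (Chains W)).toLinearMap ∘ₗ cone b θ c)
    (θ + cone b θ c ∘ₗ (bd : Derivation (ZMod 2) (Chains V) (Chains V)).toLinearMap)
    (fun s => ?_) p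
  change bd (cone b θ c (simplex s)) = θ (simplex s) + cone b θ c (bd (simplex s))
  induction s using simplex_induction with
  | h s ih =>
    by_cases hs : s = 0
    · subst hs; simp [hc]
    rw [cone_simplex b θ c hs, bd_X_mul]
    have : bd (cone b θ c (bd (simplex s))) = θ (bd (simplex s)) := by
      have h1 : bd (cone b θ c (bd (simplex s)))
          = θ (bd (simplex s)) + cone b θ c (bd (bd (simplex s))) := by
        rw [bd_simplex s]
        simp only [map_multiset_sum, Multiset.map_map, ← Multiset.sum_map_add]
        refine congrArg _ (Multiset.map_congr rfl fun v hv => ?_)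
        exact ih _ (by simpa using Multiset.card_erase_lt_of_mem hv)
      rw [h1, bd_bd, map_zero, add_zero]
    rw [map_add, hθ, this, add_self_chain, mul_zero, add_zero]

lemma cone_rename {τ : V → V} {σ : W → W} (hb : ∀ s, b (s.map τ) = σ (b s))
    (hθ : ∀ p, θ (rename τ p) = rename σ (θ p)) (hc : rename σ c = c) (p : Chains V) :
    cone b θ c (rename τ p) = rename σ (cone b θ c p) := by
  classical
  refine chain_ext
    (cone b θ c ∘ₗ (rename τ : Chains V →ₐ[ZMod 2] Chains V).toLinearMap)
    ((rename σ : Chains W →ₐ[ZMod 2] Chains W).toLinearMap ∘ₗ cone b θ c)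
    (fun s => ?_) p
  change cone b θ c (rename τ (simplex s)) = rename σ (cone b θ c (simplex s))
  induction s using simplex_induction with
  | h s ih =>
    by_cases hs : s = 0
    · subst hs; simp [hc]
    rw [cone_simplex b θ c hs, rename_simplex, cone_simplex b θ c (by simpa using hs), hb,
      ← rename_simplex, hθ, bd_rename, map_mul, rename_X, map_add]
    congr 2
    rw [bd_simplex s]
    simp only [map_multiset_sum, Multiset.map_map]
    refine congrArg _ (Multiset.map_congr rfl fun v hv => ?_)
    exact ih _ (by simpa using Multiset.card_erase_lt_of_mem hv)

lemma cone_simplex_mem [DecidableEq V] {Q : Multiset V → Set (Multiset W)} (hc : c ∈ chainsOn (Q 0))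
    (hθ : ∀ s ≠ 0, θ (simplex s) ∈ chainsOn {t | b s ::ₘ t ∈ Q s})
    (hQ : ∀ s, ∀ v ∈ s, ∀ t ∈ Q (s.erase v), b s ::ₘ t ∈ Q s) (s : Multiset V) :
    cone b θ c (simplex s) ∈ chainsOn (Q s) := by
  induction s using simplex_induction with
  | h s ih =>
    by_cases hs : s = 0
    · subst hs; simpa using hc
    rw [cone_simplex b θ c hs]
    refine map_mem_of_simplex (S := {t | b s ::ₘ t ∈ Q s})
      (LinearMap.mulLeft (ZMod 2) (X (b s)))
      (fun t ht => by simpa using simplex_mem (S := Q s) ht) ?_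
    refine Submodule.add_mem _ (hθ s hs) ?_
    rw [bd_simplex, map_multiset_sum, Multiset.map_map]
    refine multiset_sum_mem _ fun p hp => ?_
    obtain ⟨v, hv, rfl⟩ := Multiset.mem_map.1 hp
    exact chainsOn_mono (fun t ht => hQ s v hv t ht)
      (ih _ (by simpa using Multiset.card_erase_lt_of_mem hv))

end Cone

section Algebra

variable {A : Type*} [CommRing A] (d : A →+ A) (T : A →+* A)

/-- The sequence of hemispheres of a join of two spheres. -/
def joinSeq (q : ℕ) (h h' : ℕ → A) (j : ℕ) : A :=
  if j ≤ q then h j else (h q + T (h q)) * h' (j - (q + 1))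

variable {d T} {q q' : ℕ} {h h' : ℕ → A}

lemma d_joinSeq (hd : ∀ x y, d (x * y) = d x * y + x * d y) (hT : ∀ x, T (T x) = x)
    (h0' : d (h' 0) = 1) (hs : ∀ j < q, d (h (j + 1)) = h j + T (h j))
    (hz : d (h q + T (h q)) = 0)
    (hs' : ∀ j < q', d (h' (j + 1)) = h' j + T (h' j)) {j : ℕ} (hj : j < q + q' + 1) :
    d (joinSeq T q h h' (j + 1)) = joinSeq T q h h' j + T (joinSeq T q h h' j) := by
  unfold joinSeq
  rcases lt_trichotomy j q with hjq | rfl | hjq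
  · rw [if_pos (by omega), if_pos (by omega), hs j hjq]
  · simp [hd, h0', hz]
  · obtain ⟨i, rfl⟩ : ∃ i, j = q + 1 + i := ⟨j - (q + 1), by omega⟩
    rw [if_neg (by omega), if_neg (by omega), show q + 1 + i + 1 - (q + 1) = i + 1 by omega,
      show q + 1 + i - (q + 1) = i by omega, hd, hz, hs' i (by omega), map_mul, map_add, hT]
    ring

/-- `T` to the power `b + 1`. -/
def twist (T : A →+* A) (b : ℕ) (x : A) : A := if Even b then T x else x

/-- The correction term relating the hemispheres of a join to their images under the swap. -/
def swapSeq (T : A →+* A) (h h' : ℕ → A) : ℕ → A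
  | 0 => h 0
  | j + 1 => ∑ p ∈ Finset.HasAntidiagonal.antidiagonal j, twist T p.2 (h p.1) * h' p.2 +
      if Even (j + 1) then h (j + 1) else 0

lemma sum_antidiagonal_ite (q j : ℕ) (f : ℕ → ℕ → A) :
    ∑ p ∈ Finset.HasAntidiagonal.antidiagonal j, (if p.1 = q then f p.1 p.2 else 0) =
      if q ≤ j then f q (j - q) else 0 := by
  rw [Finset.Nat.sum_antidiagonal_eq_sum_range_succ (fun a b => if a = q then f a b else 0)]
  simp [Finset.sum_ite_eq']

lemma sum_antidiagonal_ite' (q j : ℕ) (f : ℕ → ℕ → A) :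
    ∑ p ∈ Finset.HasAntidiagonal.antidiagonal j, (if p.2 = q then f p.1 p.2 else 0) =
      if q ≤ j then f (j - q) q else 0 := by
  rw [← Finset.Nat.sum_antidiagonal_swap]
  exact sum_antidiagonal_ite q j fun a b => f b a

lemma d_swapSeq [CharP A 2] (hd : ∀ x y, d (x * y) = d x * y + x * d y)
    (hdT : ∀ x, d (T x) = T (d x)) (hT : ∀ x, T (T x) = x) (h0 : d (h 0) = 1)
    (h0' : d (h' 0) = 1) (hq : Even q) (hq1 : ∀ j, q < j → h j = 0)
    (hq1' : ∀ j, q < j → h' j = 0)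
    (hs : ∀ j, d (h (j + 1)) = h j + T (h j) + if j = q then h q + T (h q) else 0)
    (hs' : ∀ j, d (h' (j + 1)) = h' j + T (h' j) + if j = q then h' q + T (h' q) else 0)
    (j : ℕ) :
    d (swapSeq T h h' (j + 1)) + (joinSeq T q h h' j + joinSeq T q h' h j) =
      swapSeq T h h' j + T (swapSeq T h h' j) := by
  have two : ∀ x : A, x + x = 0 := CharTwo.add_self_eq_zero
  have d1 : d 1 = 0 := by
    have := hd 1 1
    simpa using this
  set S := h q + T (h q) with hS
  set S' := h' q + T (h' q) with hS'
  have tw0 : ∀ b, d (twist T b (h 0)) = 1 := fun b => by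
    unfold twist; split_ifs <;> simp [hdT, h0]
  have tw1 : ∀ b a, d (twist T b (h (a + 1))) = h a + T (h a) + if a = q then S else 0 :=
    fun b a => by
      have hTS : T S = S := by rw [hS, map_add, hT, add_comm]
      unfold twist
      by_cases hb : Even b
      · rw [if_pos hb, hdT, hs, map_add, map_add, hT, apply_ite T, map_zero, hTS]; ring
      · rw [if_neg hb, hs]
  rcases j with _ | j
  · simp only [swapSeq, zero_add, Finset.HasAntidiagonal.antidiagonal_zero, Finset.sum_singleton,
      joinSeq,
      Nat.zero_le, if_true, Nat.not_even_one, if_false, add_zero, hd, tw0, h0']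
    simp only [twist, Even.zero, if_true]
    linear_combination two (h' 0)
  have key : d (∑ p ∈ Finset.HasAntidiagonal.antidiagonal (j + 1), twist T p.2 (h p.1) * h' p.2) =
      h' (j + 1) + T (h (j + 1)) +
      ∑ p ∈ Finset.HasAntidiagonal.antidiagonal j, ((h p.1 + T (h p.1)) * h' p.2 +
        twist T (p.2 + 1) (h p.1) * (h' p.2 + T (h' p.2))) +
      if q ≤ j then S * h' (j - q) + h (j - q) * S' else 0 := by
    simp only [map_sum, hd, Finset.sum_add_distrib]
    rw [Finset.Nat.sum_antidiagonal_succ, Finset.Nat.sum_antidiagonal_succ']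
    simp only [tw0, tw1, hs', h0', add_mul, mul_add, Finset.sum_add_distrib, ite_mul, mul_ite,
      zero_mul, mul_zero]
    have e1 := sum_antidiagonal_ite q j fun _ b => S * h' b
    have e2 := sum_antidiagonal_ite' q j fun a b => twist T (b + 1) (h a) * S'
    have e3 : ∀ a, twist T (q + 1) (h a) = h a := fun a => by
      simp [twist, Nat.even_add_one, hq]
    simp only [e3] at e2
    have e4 : ∀ a, twist T 0 (h a) = T (h a) := fun a => by simp [twist]
    simp only [e4]
    rw [e1, e2]
    split_ifs <;> simp [one_mul] <;> ring
  have interior : ∑ p ∈ Finset.HasAntidiagonal.antidiagonal j, ((h p.1 + T (h p.1)) * h' p.2 +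
        twist T (p.2 + 1) (h p.1) * (h' p.2 + T (h' p.2))) =
      ∑ p ∈ Finset.HasAntidiagonal.antidiagonal j, twist T p.2 (h p.1) * h' p.2 +
        T (∑ p ∈ Finset.HasAntidiagonal.antidiagonal j, twist T p.2 (h p.1) * h' p.2) := by
    rw [map_sum, ← Finset.sum_add_distrib]
    refine Finset.sum_congr rfl fun p _ => ?_
    unfold twist
    by_cases hp : Even p.2
    · rw [if_neg (by simpa [Nat.even_add_one] using hp), if_pos hp, map_mul, hT]
      linear_combination two (h p.1 * h' p.2)
    · rw [if_pos (by simpa [Nat.even_add_one] using hp), if_neg hp, map_mul]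
      linear_combination two (T (h p.1) * h' p.2)
  have tail : d (if Even (j + 1 + 1) then h (j + 1 + 1) else 0) =
      if Even (j + 1) then 0 else h (j + 1) + T (h (j + 1)) := by
    by_cases hj : Even (j + 1)
    · rw [if_neg (by simpa [Nat.even_add_one] using hj), if_pos hj, map_zero]
    · rw [if_pos (by simpa [Nat.even_add_one] using hj), if_neg hj, hs,
        if_neg (by rintro rfl; exact hj hq), add_zero]
  rw [swapSeq, map_add, key, interior, tail, swapSeq, map_add]
  unfold joinSeq
  by_cases hj : j + 1 ≤ q
  · rw [if_neg (by omega), if_pos hj, if_pos hj]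
    split_ifs
    · linear_combination two (h' (j + 1))
    · rw [map_zero]
      linear_combination two (h' (j + 1)) + two (h (j + 1)) + two (T (h (j + 1)))
  · rw [if_pos (by omega), if_neg hj, if_neg hj, hq1 (j + 1) (by omega), hq1' (j + 1) (by omega),
      show j + 1 - (q + 1) = j - q by omega]
    simp only [map_zero, ite_self, add_zero, zero_add]
    linear_combination two (S * h' (j - q)) + two (S' * h (j - q))

end Algebra

section Hemispheres

variable {V W : Type*}

/-- The complex `S`, with its involution `τ`, carries chains that look like the hemispheres of
dimensions `0, …, q` of a `q`-sphere with the antipodal map. -/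
def HasHemispheres (τ : V → V) (S : Set (Multiset V)) (q : ℕ) : Prop :=
  ∃ h : ℕ → Chains V, bd (h 0) = 1 ∧ (∀ j < q, bd (h (j + 1)) = h j + rename τ (h j)) ∧
    ∀ j ≤ q, h j ∈ chainsOn {s | s ∈ S ∧ s.card = j + 1}

lemma HasHemispheres.map {τ : V → V} {σ : W → W} {S : Set (Multiset V)} {S' : Set (Multiset W)}
    {q : ℕ} (H : HasHemispheres τ S q) (f : V → W) (hf : ∀ v, f (τ v) = σ (f v))
    (hS : ∀ s ∈ S, s.map f ∈ S') : HasHemispheres σ S' q := by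
  obtain ⟨h, h0, hs, hm⟩ := H
  refine ⟨fun j => rename f (h j), by simp [bd_rename, h0], fun j hj => ?_, fun j hj => ?_⟩
  · rw [bd_rename, hs j hj, map_add, rename_rename, rename_rename]
    congr 3
    exact funext hf
  · refine rename_mem f (fun s hs => ?_) (hm j hj)
    exact ⟨hS s hs.1, by simpa using hs.2⟩

lemma HasHemispheres.cone {τ : V → V} {σ : W → W} {S : Set (Multiset V)} {S' : Set (Multiset W)}
    {q : ℕ} (H : HasHemispheres τ S q) (b : Multiset V → W) (hb : ∀ s, b (s.map τ) = σ (b s))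
    (hS : ∀ s ∈ S, s.card ≤ q + 1 →
      ChordChains.cone b 0 1 (simplex s) ∈ chainsOn {t | t ∈ S' ∧ t.card = s.card}) :
    HasHemispheres σ S' q := by
  obtain ⟨h, h0, hs, hm⟩ := H
  have hbd : ∀ p, bd (ChordChains.cone b 0 1 p) = ChordChains.cone b 0 1 (bd p) := fun p => by
    simpa using bd_cone b 0 1 (by simp) (by simp) p
  refine ⟨fun j => ChordChains.cone b 0 1 (h j), by simp [hbd, h0], fun j hj => ?_,
    fun j hj => ?_⟩
  · rw [hbd, hs j hj, map_add, cone_rename b 0 1 hb (by simp) (by simp)]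
  · refine map_mem_of_simplex _ (fun s hs => ?_) (hm j hj)
    exact hs.2 ▸ hS s hs.1 (by have := hs.2; omega)

/-- Modulo two indicator of the alternating simplices, labelled by nonzero integers of absolute
value at most `N`, in which the vertex of smallest absolute value is positive (up to a global
sign convention depending on the dimension). -/
def altSign : ℕ → Multiset ℤ → ZMod 2
  | 0, s => if s = 0 then 1 else 0
  | N + 1, s =>
    if -(N + 1 : ℤ) ∈ s then 0
    else if s.count (N + 1 : ℤ) = 0 then altSign N s
    else if s.count (N + 1 : ℤ) = 1 then altSign N ((s.erase (N + 1 : ℤ)).map Neg.neg)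
    else 0

/-- Labels bounded by `N`, with no complementary pair. -/
def Admissible (N : ℕ) (s : Multiset ℤ) : Prop := ∀ a ∈ s, a ≠ 0 ∧ |a| ≤ N ∧ -a ∉ s

lemma altSign_eq_zero_of_card {N : ℕ} {s : Multiset ℤ} (hs : N < s.card) : altSign N s = 0 := by
  induction N generalizing s with
  | zero => rw [altSign, if_neg (by rintro rfl; simp at hs)]
  | succ N ih =>
    rw [altSign]
    split_ifs with h1 h2 h3
    · rfl
    · exact ih (by omega)
    · have : (N + 1 : ℤ) ∈ s := Multiset.count_pos.1 (by omega)
      have := Multiset.card_erase_add_one this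
      exact ih (by rw [Multiset.card_map]; omega)
    · rfl

@[simp] lemma altSign_zero (N : ℕ) : altSign N 0 = 1 := by
  induction N with
  | zero => simp [altSign]
  | succ N ih => simp [altSign, ih]

lemma map_erase_neg (s : Multiset ℤ) (v : ℤ) :
    (s.erase v).map Neg.neg = (s.map Neg.neg).erase (-v) :=
  Multiset.map_erase _ neg_injective _ _

lemma Admissible.neg {N : ℕ} {s : Multiset ℤ} (h : Admissible N s) :
    Admissible N (s.map Neg.neg) := by
  intro a ha
  obtain ⟨b, hb, rfl⟩ := Multiset.mem_map.1 ha
  obtain ⟨h1, h2, h3⟩ := h b hb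
  refine ⟨by simpa using h1, by simpa using h2, fun hc => ?_⟩
  obtain ⟨c, hc, hc'⟩ := Multiset.mem_map.1 hc
  rw [neg_neg] at hc'
  exact h3 (by rw [← hc']; simpa using hc)

lemma Admissible.lower {N : ℕ} {s : Multiset ℤ} (h : Admissible (N + 1) s)
    (h1 : (N + 1 : ℤ) ∉ s) (h2 : -(N + 1 : ℤ) ∉ s) : Admissible N s := by
  intro a ha
  obtain ⟨h3, h4, h5⟩ := h a ha
  refine ⟨h3, ?_, h5⟩
  push_cast at h4
  have : a ≠ N + 1 := fun h => h1 (h ▸ ha)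
  have : a ≠ -(N + 1) := fun h => h2 (h ▸ ha)
  rw [abs_le] at h4 ⊢
  omega

lemma Admissible.of_cons {N : ℕ} {a : ℤ} {s : Multiset ℤ} (h : Admissible N (a ::ₘ s)) :
    Admissible N s := fun b hb =>
  ⟨(h b (by simp [hb])).1, (h b (by simp [hb])).2.1,
    fun hc => (h b (by simp [hb])).2.2 (by simp [hc])⟩

/-- Ky Fan's counting identity. -/
lemma sum_altSign_erase {N : ℕ} {s : Multiset ℤ} (hs : Admissible N s) :
    (s.map fun v => altSign N (s.erase v)).sum = altSign N s + altSign N (s.map Neg.neg) := by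
  have two : ∀ x : ZMod 2, x + x = 0 := CharTwo.add_self_eq_zero
  induction N generalizing s with
  | zero =>
    have : s = 0 := Multiset.eq_zero_of_forall_notMem fun a ha => by
      obtain ⟨h1, h2, -⟩ := hs a ha
      simp at h2
      exact h1 h2
    subst this
    simp [two]
  | succ N ih =>
    by_cases hp : (N + 1 : ℤ) ∈ s
    · have hn : -(N + 1 : ℤ) ∉ s := (hs _ hp).2.2
      obtain ⟨s, rfl⟩ := Multiset.exists_cons_of_mem hp
      have hn' : -(N + 1 : ℤ) ∉ s := fun h => hn (Multiset.mem_cons_of_mem h)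
      have hneg : altSign (N + 1) (((N + 1 : ℤ) ::ₘ s).map Neg.neg) = 0 := by
        rw [altSign, if_pos (by simp)]
      have hc : ∀ v ∈ s, ((N + 1 : ℤ) ::ₘ s).erase v = (N + 1 : ℤ) ::ₘ s.erase v :=
        fun v hv => Multiset.erase_cons_tail_of_mem hv
      rw [hneg, Multiset.map_cons, Multiset.sum_cons, Multiset.erase_cons_head, add_zero]
      by_cases hp' : (N + 1 : ℤ) ∈ s
      · obtain ⟨s, rfl⟩ := Multiset.exists_cons_of_mem hp'
        have hz : ∀ t : Multiset ℤ, 2 ≤ t.count (N + 1 : ℤ) → altSign (N + 1) t = 0 := by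
          intro t ht
          rw [altSign, if_neg (by omega : ¬ t.count (N + 1 : ℤ) = 0),
            if_neg (by omega : ¬ t.count (N + 1 : ℤ) = 1), ite_self]
        rw [Multiset.map_cons, Multiset.sum_cons, Multiset.erase_cons_tail_of_mem (by simp),
          Multiset.erase_cons_head, ← add_assoc, two, zero_add, hz _ (by simp)]
        refine Multiset.sum_eq_zero fun x hx => ?_
        obtain ⟨v, hv, rfl⟩ := Multiset.mem_map.1 hx
        refine hz _ ?_
        rw [hc v (by simp [hv]), Multiset.erase_cons_tail_of_mem hv]
        simp
      · have hl := hs.of_cons.lower hp' hn'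
        have e1 : altSign (N + 1) s = altSign N s := by
          rw [altSign, if_neg hn', if_pos (Multiset.count_eq_zero.2 hp')]
        have e2 : ∀ t : Multiset ℤ, t ≤ s → altSign (N + 1) ((N + 1 : ℤ) ::ₘ t) =
            altSign N (t.map Neg.neg) := by
          intro t ht
          have h1 : (N + 1 : ℤ) ∉ t := fun h => hp' (Multiset.mem_of_le ht h)
          have h2 : -(N + 1 : ℤ) ∉ (N + 1 : ℤ) ::ₘ t := fun h =>
            hn (Multiset.mem_of_le (Multiset.cons_le_cons _ ht) h)
          rw [altSign, if_neg h2]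
          simp [Multiset.count_eq_zero.2 h1]
        have e3 : (s.map fun v => altSign (N + 1) (((N + 1 : ℤ) ::ₘ s).erase v)) =
            (s.map Neg.neg).map fun v => altSign N ((s.map Neg.neg).erase v) := by
          rw [Multiset.map_map]
          refine Multiset.map_congr rfl fun v hv => ?_
          rw [hc v hv, e2 _ (Multiset.erase_le _ _), map_erase_neg]
          rfl
        rw [e1, e2 _ le_rfl, e3, ih hl.neg, Multiset.map_map]
        simp only [Function.comp_def, neg_neg, Multiset.map_id']
        linear_combination two (altSign N s)
    · by_cases hn : -(N + 1 : ℤ) ∈ s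
      · obtain ⟨s, rfl⟩ := Multiset.exists_cons_of_mem hn
        have hp' : (N + 1 : ℤ) ∉ s := fun h => hp (by simp [h])
        have hz : ∀ t : Multiset ℤ, -(N + 1 : ℤ) ∈ t → altSign (N + 1) t = 0 := by
          intro t ht
          rw [altSign, if_pos ht]
        have hc : ∀ v ∈ s, (-(N + 1 : ℤ) ::ₘ s).erase v = -(N + 1 : ℤ) ::ₘ s.erase v :=
          fun v hv => Multiset.erase_cons_tail_of_mem hv
        have e1 : (s.map fun v => altSign (N + 1) ((-(N + 1 : ℤ) ::ₘ s).erase v)).sum = 0 := by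
          refine Multiset.sum_eq_zero fun x hx => ?_
          obtain ⟨v, hv, rfl⟩ := Multiset.mem_map.1 hx
          exact hz _ (by rw [hc v hv]; simp)
        rw [Multiset.map_cons, Multiset.sum_cons, Multiset.erase_cons_head, e1, add_zero,
          hz (-(N + 1 : ℤ) ::ₘ s) (by simp), zero_add, Multiset.map_cons, neg_neg]
        have h3 : -(N + 1 : ℤ) ∉ (N + 1 : ℤ) ::ₘ s.map Neg.neg := by
          simp only [Multiset.mem_cons, Multiset.mem_map, not_or]
          refine ⟨by omega, ?_⟩
          rintro ⟨a, ha, h⟩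
          exact hp' (by rwa [← neg_injective h])
        have hcount : (s.map Neg.neg).count (N + 1 : ℤ) = s.count (-(N + 1 : ℤ)) := by
          have := Multiset.count_map_eq_count' (Neg.neg : ℤ → ℤ) s neg_injective (-(N + 1 : ℤ))
          rwa [neg_neg] at this
        rw [altSign, altSign, if_neg h3, Multiset.count_cons_self, hcount]
        by_cases hn' : -(N + 1 : ℤ) ∈ s
        · have := Multiset.count_pos.2 hn'
          rw [if_pos hn', if_neg (by omega), if_neg (by omega)]
        · have := Multiset.count_eq_zero.2 hn'
          rw [if_neg hn', if_pos (Multiset.count_eq_zero.2 hp'), if_neg (by omega),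
            if_pos (by omega), Multiset.erase_cons_head, Multiset.map_map]
          simp
      · have e : ∀ t : Multiset ℤ, (N + 1 : ℤ) ∉ t → -(N + 1 : ℤ) ∉ t →
            altSign (N + 1) t = altSign N t := by
          intro t h1 h2
          rw [altSign, if_neg h2, if_pos (Multiset.count_eq_zero.2 h1)]
        have e1 : (s.map fun v => altSign (N + 1) (s.erase v)) =
            s.map fun v => altSign N (s.erase v) := by
          refine Multiset.map_congr rfl fun v _ => e _ ?_ ?_
          · exact fun h => hp (Multiset.mem_of_mem_erase h)
          · exact fun h => hn (Multiset.mem_of_mem_erase h)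
        rw [e1, ih (hs.lower hp hn), e s hp hn, e]
        · rintro h
          obtain ⟨a, ha, h⟩ := Multiset.mem_map.1 h
          exact hn (by rw [← h, neg_neg]; exact ha)
        · rintro h
          obtain ⟨a, ha, h⟩ := Multiset.mem_map.1 h
          exact hp (by rwa [← neg_injective h])

/-- Ky Fan's lemma: a labelled sphere of dimension at least `N` has a complementary edge. -/
lemma not_hasHemispheres_admissible {N q : ℕ} (hq : N ≤ q) :
    ¬ HasHemispheres (Neg.neg : ℤ → ℤ) {s | Admissible N s} q := by
  rintro ⟨h, h0, hs, hm⟩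
  obtain ⟨u, hu⟩ : ∃ u : Chains ℤ →ₗ[ZMod 2] ZMod 2, ∀ s, u (simplex s) = altSign N s :=
    ⟨extend (altSign N), extend_simplex _⟩
  have hub : ∀ p ∈ chainsOn {s | Admissible N s}, u (bd p) = u (p + rename Neg.neg p) := by
    intro p hp
    refine eq_of_simplex
      (u ∘ₗ (bd : Derivation (ZMod 2) (Chains ℤ) (Chains ℤ)).toLinearMap)
      (u ∘ₗ (LinearMap.id + (rename Neg.neg : Chains ℤ →ₐ[ZMod 2] Chains ℤ).toLinearMap))
      (fun s hs => ?_) hp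
    change u (bd (simplex s)) = u (simplex s + rename Neg.neg (simplex s))
    rw [bd_simplex, map_multiset_sum, Multiset.map_map, rename_simplex, map_add, hu, hu,
      ← sum_altSign_erase hs]
    simp [hu]
  have hm' : ∀ j ≤ q, h j ∈ chainsOn {s | Admissible N s} := fun j hj =>
    chainsOn_mono (fun s hs => hs.1) (hm j hj)
  have h1 : ∀ j ≤ q, u (h j + rename Neg.neg (h j)) = 1 := by
    intro j hj
    induction j with
    | zero =>
      rw [← hub _ (hm' 0 hj), h0, ← simplex_zero, hu, altSign_zero]
    | succ j ih => rw [← hub _ (hm' _ hj), hs j hj, ih (by omega)]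
  have h2 : u (h q + rename Neg.neg (h q)) = 0 := by
    refine eq_of_simplex
      (u ∘ₗ (LinearMap.id + (rename Neg.neg : Chains ℤ →ₐ[ZMod 2] Chains ℤ).toLinearMap)) 0
      (fun s hs => ?_) (hm q le_rfl)
    change u (simplex s + rename Neg.neg (simplex s)) = 0
    rw [rename_simplex, map_add, hu, hu,
      altSign_eq_zero_of_card (by have := hs.2; omega),
      altSign_eq_zero_of_card (by have := hs.2; rw [Multiset.card_map]; omega), add_zero]
  exact one_ne_zero ((h1 q le_rfl).symm.trans h2)

end Hemispheres

section Subdivision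

variable {E : Type*} [NormedAddCommGroup E] [NormedSpace ℝ E]

/-- The barycenter of a finite family of points. -/
noncomputable def barycenter {V : Type*} [AddCommGroup V] [Module ℝ V] (s : Multiset V) : V :=
  (s.card : ℝ)⁻¹ • s.sum

/-- The convex hull of a finite family of points. -/
def hull {V : Type*} [AddCommGroup V] [Module ℝ V] (s : Multiset V) : Set V :=
  convexHull ℝ {x | x ∈ s}

lemma barycenter_map {V W : Type*} [AddCommGroup V] [Module ℝ V] [AddCommGroup W] [Module ℝ W]
    (f : V →ₗ[ℝ] W) (s : Multiset V) : barycenter (s.map f) = f (barycenter s) := by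
  simp [barycenter, map_multiset_sum]

lemma barycenter_neg {V : Type*} [AddCommGroup V] [Module ℝ V] (s : Multiset V) :
    barycenter (s.map Neg.neg) = -barycenter s :=
  barycenter_map (-LinearMap.id) s

lemma barycenter_mem {V : Type*} [AddCommGroup V] [Module ℝ V] {s : Multiset V} (hs : s ≠ 0)
    {C : Set V} (hC : Convex ℝ C) (h : ∀ x ∈ s, x ∈ C) : barycenter s ∈ C := by
  induction s using Multiset.induction_on with
  | empty => exact absurd rfl hs
  | cons a s ih =>
    by_cases h0 : s = 0
    · subst h0; simpa [barycenter] using h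
    have hb := ih h0 fun x hx => h x (Multiset.mem_cons_of_mem hx)
    have hk : (0 : ℝ) < s.card := by exact_mod_cast Multiset.card_pos.2 h0
    have : barycenter (a ::ₘ s) = ((s.card : ℝ) + 1)⁻¹ • a +
        ((s.card : ℝ) / (s.card + 1)) • barycenter s := by
      simp only [barycenter, Multiset.card_cons, Multiset.sum_cons, smul_add, smul_smul]
      congr 2 <;> push_cast
      · rfl
      · field_simp
    rw [this]
    exact hC (h a (Multiset.mem_cons_self a s)) hb (by positivity) (by positivity)
      (by field_simp; ring)

lemma hull_mono {V : Type*} [AddCommGroup V] [Module ℝ V] {s t : Multiset V}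
    (h : ∀ x ∈ s, x ∈ hull t) : hull s ⊆ hull t :=
  convexHull_min h (convex_convexHull ℝ _)

lemma mem_hull {V : Type*} [AddCommGroup V] [Module ℝ V] {s : Multiset V} {x : V} (h : x ∈ s) :
    x ∈ hull s := subset_convexHull ℝ _ h

lemma norm_barycenter_sub_le {s : Multiset E} {δ : ℝ} {m : ℕ} (hm : s.card ≤ m + 1)
    (h : ∀ x ∈ s, ∀ y ∈ s, ‖x - y‖ ≤ δ) {y : E} (hy : y ∈ hull s) :
    ‖barycenter s - y‖ ≤ m / (m + 1) * δ := by
  have hsub : hull s ⊆ Metric.closedBall (barycenter s) (m / (m + 1) * δ) := by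
    refine convexHull_min (fun v hv => ?_) (convex_closedBall _ _)
    obtain ⟨t, rfl⟩ := Multiset.exists_cons_of_mem hv
    have hδ : 0 ≤ δ := (norm_nonneg _).trans (h v hv v hv)
    have e : barycenter (v ::ₘ t) - v =
        ((t.card : ℝ) + 1)⁻¹ • (t.map fun w => w - v).sum := by
      have hk : ((t.card : ℝ) + 1) ≠ 0 := by positivity
      rw [Multiset.sum_map_sub, Multiset.map_id', Multiset.map_const', Multiset.sum_replicate,
        barycenter, Multiset.card_cons, Multiset.sum_cons]
      apply (smul_right_injective E hk)
      simp only [smul_sub, smul_smul, smul_add]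
      push_cast
      simp only [mul_inv_cancel₀ hk, add_smul, one_smul, Nat.cast_smul_eq_nsmul]
      abel
    rw [Metric.mem_closedBall, dist_comm, dist_eq_norm, e, norm_smul, Real.norm_eq_abs,
      abs_of_nonneg (by positivity)]
    have h1 : ‖(t.map fun w => w - v).sum‖ ≤ t.card * δ := by
      refine (norm_multiset_sum_le _).trans ?_
      have := Multiset.sum_le_card_nsmul ((t.map fun w => w - v).map fun x => ‖x‖) δ (by
        intro x hx
        simp only [Multiset.mem_map, exists_exists_and_eq_and] at hx
        obtain ⟨w, hw, rfl⟩ := hx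
        exact h w (Multiset.mem_cons_of_mem hw) v hv)
      simpa using this
    have hm' : (t.card : ℝ) ≤ m := by
      have : t.card ≤ m := by simpa using hm
      exact_mod_cast this
    calc ((t.card : ℝ) + 1)⁻¹ * ‖(t.map fun w => w - v).sum‖
        ≤ ((t.card : ℝ) + 1)⁻¹ * (t.card * δ) := by gcongr
      _ = t.card / (t.card + 1) * δ := by ring
      _ ≤ m / (m + 1) * δ := by
        gcongr ?_ * δ
        rw [div_le_div_iff₀ (by positivity) (by positivity)]
        linarith
  have := hsub hy
  rwa [Metric.mem_closedBall, dist_comm, dist_eq_norm] at this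

/-- Simplices of diameter at most `D` staying at distance at least `δ` from the origin. -/
def awaySimplices (E : Type*) [NormedAddCommGroup E] [NormedSpace ℝ E] (δ D : ℝ) :
    Set (Multiset E) :=
  {s | (∀ x ∈ hull s, δ ≤ ‖x‖) ∧ ∀ x ∈ s, ∀ y ∈ s, ‖x - y‖ ≤ D}

lemma HasHemispheres.subdivide {δ D : ℝ} {q : ℕ}
    (H : HasHemispheres (Neg.neg : E → E) (awaySimplices E δ D) q) :
    HasHemispheres (Neg.neg : E → E) (awaySimplices E δ (q / (q + 1) * D)) q := by
  classical
  refine H.cone barycenter barycenter_neg fun s hs hcard => ?_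
  have := cone_simplex_mem (V := E) (W := E) barycenter 0 1
    (Q := fun s => {t | t.card = s.card ∧ (∀ x ∈ t, x ∈ hull s) ∧
      ∀ D', s.card ≤ q + 1 → (∀ x ∈ s, ∀ y ∈ s, ‖x - y‖ ≤ D') →
        ∀ x ∈ t, ∀ y ∈ t, ‖x - y‖ ≤ q / (q + 1) * D'})
    (by rw [← simplex_zero]; exact simplex_mem (by simp)) (by simp) ?_ s
  · refine chainsOn_mono ?_ this
    rintro t ⟨h1, h2, h3⟩
    exact ⟨⟨fun x hx => hs.1 x (hull_mono h2 hx), h3 D hcard hs.2⟩, h1⟩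
  · rintro s v hv t ⟨h1, h2, h3⟩
    have hs0 : s ≠ 0 := by rintro rfl; simp at hv
    have hle := Multiset.erase_le v s
    have hh : ∀ x ∈ t, x ∈ hull s := fun x hx =>
      hull_mono (fun y hy => mem_hull (Multiset.mem_of_le hle hy)) (h2 x hx)
    refine ⟨?_, ?_, fun D' hc hD x hx y hy => ?_⟩
    · rw [Multiset.card_cons, h1, Multiset.card_erase_add_one hv]
    · intro x hx
      rcases Multiset.mem_cons.1 hx with rfl | hx
      · exact barycenter_mem hs0 (convex_convexHull ℝ _) fun x hx => mem_hull hx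
      · exact hh x hx
    · have hD0 : 0 ≤ D' := (norm_nonneg _).trans (hD v hv v hv)
      rcases Multiset.mem_cons.1 hx with rfl | hx <;> rcases Multiset.mem_cons.1 hy with rfl | hy
      · rw [sub_self, norm_zero]; positivity
      · exact norm_barycenter_sub_le hc hD (hh y hy)
      · rw [norm_sub_rev]; exact norm_barycenter_sub_le hc hD (hh x hx)
      · exact h3 D' ((Multiset.card_le_card hle).trans hc)
          (fun x hx y hy => hD x (Multiset.mem_of_le hle hx) y (Multiset.mem_of_le hle hy))
          x hx y hy

lemma HasHemispheres.subdivide_iterate {δ D : ℝ} {q : ℕ}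
    (H : HasHemispheres (Neg.neg : E → E) (awaySimplices E δ D) q) (r : ℕ) :
    HasHemispheres (Neg.neg : E → E) (awaySimplices E δ ((q / (q + 1) : ℝ) ^ r * D)) q := by
  induction r with
  | zero => simpa using H
  | succ r ih =>
    have := ih.subdivide
    rwa [← mul_assoc, ← pow_succ'] at this

end Subdivision

section BorsukUlam

variable {N : ℕ}

/-- An index of a coordinate of absolute value at least `δ`, if there is one. -/
noncomputable def labelIndex (δ : ℝ) (x : Fin N → ℝ) : ℕ :=
  Classical.epsilon fun k => ∃ h : k < N, δ ≤ |x ⟨k, h⟩|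

/-- The signed label of a vector: a large coordinate, with its sign. -/
noncomputable def label (δ : ℝ) (x : Fin N → ℝ) : ℤ :=
  if h : labelIndex δ x < N then SignType.sign (x ⟨labelIndex δ x, h⟩) * (labelIndex δ x + 1)
  else 0

lemma labelIndex_neg (δ : ℝ) (x : Fin N → ℝ) : labelIndex δ (-x) = labelIndex δ x := by
  simp [labelIndex]

lemma label_neg (δ : ℝ) (x : Fin N → ℝ) : label δ (-x) = -label δ x := by
  unfold label
  simp only [labelIndex_neg, Pi.neg_apply, Left.sign_neg]
  split_ifs <;> simp

lemma exists_label {δ : ℝ} (hδ : 0 < δ) {x : Fin N → ℝ} (hx : δ ≤ ‖x‖) :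
    ∃ i : Fin N, (δ ≤ x i ∧ label δ x = i + 1) ∨ (x i ≤ -δ ∧ label δ x = -(i + 1)) := by
  have hex : ∃ k, ∃ h : k < N, δ ≤ |x ⟨k, h⟩| := by
    by_contra hc
    push Not at hc
    refine absurd hx (not_le.2 ((pi_norm_lt_iff hδ).2 fun i => ?_))
    exact hc i i.2
  obtain ⟨hi, hi'⟩ : ∃ h : labelIndex δ x < N, δ ≤ |x ⟨labelIndex δ x, h⟩| :=
    Classical.epsilon_spec hex
  refine ⟨⟨_, hi⟩, ?_⟩
  rcases le_abs'.1 hi' with h | h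
  · right
    refine ⟨h, ?_⟩
    rw [label, dif_pos hi, sign_neg (by linarith)]
    simp
  · left
    refine ⟨h, ?_⟩
    rw [label, dif_pos hi, sign_pos (by linarith)]
    simp

/-- A form of the Borsuk–Ulam theorem. -/
theorem not_hasHemispheres_away {δ D : ℝ} (hδ : 0 < δ) {q : ℕ} (hq : N ≤ q) :
    ¬ HasHemispheres (Neg.neg : (Fin N → ℝ) → _) (awaySimplices (Fin N → ℝ) δ D) q := by
  intro H
  obtain ⟨r, hr⟩ : ∃ r : ℕ, (q / (q + 1) : ℝ) ^ r * D < δ := by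
    have h1 : (q / (q + 1) : ℝ) < 1 := by rw [div_lt_one (by positivity)]; linarith
    have h2 := (tendsto_pow_atTop_nhds_zero_of_lt_one (by positivity) h1).mul_const D
    rw [zero_mul] at h2
    exact (h2.eventually_lt_const hδ).exists
  refine not_hasHemispheres_admissible hq
    ((H.subdivide_iterate r).map (label δ) (label_neg δ) ?_)
  rintro s ⟨h1, h2⟩ a ha
  obtain ⟨x, hx, rfl⟩ := Multiset.mem_map.1 ha
  obtain ⟨i, hi⟩ := exists_label hδ (h1 x (mem_hull hx))
  have hiN := i.2
  refine ⟨by omega, by rw [abs_le]; omega, fun hn => ?_⟩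
  obtain ⟨y, hy, hxy⟩ := Multiset.mem_map.1 hn
  obtain ⟨j, hj⟩ := exists_label hδ (h1 y (mem_hull hy))
  have hij : i = j := Fin.ext (by omega)
  subst hij
  have h3 : |x i - y i| < δ := (norm_le_pi_norm (x - y) i).trans_lt ((h2 x hx y hy).trans_lt hr)
  rw [abs_lt] at h3
  rcases hi with ⟨a1, b1⟩ | ⟨a1, b1⟩ <;> rcases hj with ⟨a2, b2⟩ | ⟨a2, b2⟩
  · omega
  · linarith
  · linarith
  · omega

end BorsukUlam

section Null

open Filter Topology

variable {ι κ : Type*} [Fintype ι] [Fintype κ]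

/-- The weighted point set with weights `l` and positions `x` has total weight zero at every
point. -/
def Null (l x : ι → ℝ) : Prop := ∀ u : ℝ → ℝ, ∑ i, l i * u (x i) = 0

lemma null_of_fiber {l x : ι → ℝ} (h : ∀ c, ∑ i, l i * (if x i = c then 1 else 0) = 0) :
    Null l x := by
  classical
  intro u
  have : ∀ i, l i * u (x i) =
      ∑ c ∈ Finset.univ.image x, (l i * (if x i = c then 1 else 0)) * u c := fun i => by
    rw [Finset.sum_eq_single (x i)]
    · simp
    · intro c _ hc; simp [hc.symm]
    · simp
  simp_rw [this]
  rw [Finset.sum_comm]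
  exact Finset.sum_eq_zero fun c _ => by rw [← Finset.sum_mul, h, zero_mul]

lemma Null.of_affine {l x : ι → ℝ} {a r : ℝ} (hr : r ≠ 0) (h : Null l fun i => a + r * x i) :
    Null l x := fun u => by
  have := h fun w => u ((w - a) / r)
  simpa [mul_div_cancel_left₀ _ hr] using this

lemma Null.left {l : ι ⊕ κ → ℝ} {x : ι → ℝ} {y : κ → ℝ} (h : Null l (Sum.elim x y))
    (hd : ∀ i j, x i ≠ y j) : Null (l ∘ Sum.inl) x := fun u => by
  classical
  have := h fun w => if ∃ i, x i = w then u w else 0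
  simpa [Fintype.sum_sum_type, hd] using this

lemma Null.right {l : ι ⊕ κ → ℝ} {x : ι → ℝ} {y : κ → ℝ} (h : Null l (Sum.elim x y))
    (hd : ∀ i j, x i ≠ y j) : Null (l ∘ Sum.inr) y := fun u => by
  classical
  have := h fun w => if ∃ i, y i = w then u w else 0
  simpa [Fintype.sum_sum_type, fun i j => (hd i j).symm] using this

lemma sum_fiber_of_tendsto {y l : ℕ → ι → ℝ} {y₀ l₀ : ι → ℝ} (hy : Tendsto y atTop (𝓝 y₀))
    (hl : Tendsto l atTop (𝓝 l₀)) (c : ℝ)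
    (h : ∀ᶠ η in 𝓝[>] (0 : ℝ), ∀ᶠ n in atTop,
      ∑ i, l n i * (if |y n i - c| < η then 1 else 0) = 0) :
    ∑ i, l₀ i * (if y₀ i = c then 1 else 0) = 0 := by
  have h1 : ∀ᶠ η in 𝓝[>] (0 : ℝ), ∀ i, y₀ i ≠ c → η < |y₀ i - c| := by
    refine eventually_all.2 fun i => ?_
    by_cases hi : y₀ i = c
    · exact Eventually.of_forall fun _ hc => absurd hi hc
    · have : (0 : ℝ) < |y₀ i - c| := abs_pos.2 (sub_ne_zero.2 hi)
      exact (eventually_nhdsWithin_of_eventually_nhds (Iio_mem_nhds this)).mono fun _ h _ => h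
  obtain ⟨η, ⟨hη, hη1⟩, hη0⟩ := ((h.and h1).and self_mem_nhdsWithin).exists
  have hη0 : 0 < η := hη0
  have h2 : ∀ᶠ n in atTop, ∀ i, (|y n i - c| < η ↔ y₀ i = c) := by
    refine eventually_all.2 fun i => ?_
    have ht : Tendsto (fun n => |y n i - c|) atTop (𝓝 |y₀ i - c|) :=
      (((tendsto_pi_nhds.1 hy) i).sub_const c).abs
    by_cases hi : y₀ i = c
    · filter_upwards [ht.eventually (gt_mem_nhds (by simpa [hi] using hη0 : |y₀ i - c| < η))]
        with n hn
      exact ⟨fun _ => hi, fun _ => hn⟩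
    · filter_upwards [ht.eventually (lt_mem_nhds (hη1 i hi))] with n hn
      exact ⟨fun hc => absurd hc (not_lt.2 hn.le), fun hc => absurd hc hi⟩
  have h3 : Tendsto (fun n => ∑ i, l n i * (if y₀ i = c then 1 else 0)) atTop
      (𝓝 (∑ i, l₀ i * (if y₀ i = c then 1 else 0))) :=
    tendsto_finsetSum _ fun i _ => ((tendsto_pi_nhds.1 hl) i).mul_const _
  refine tendsto_nhds_unique h3 (tendsto_const_nhds.congr' ?_)
  filter_upwards [hη, h2] with n hn hn2
  exact hn.symm.trans (Finset.sum_congr rfl fun i _ => by simp only [hn2])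

/-- Uniformity of nonresonance: two marginals still determine the weights if one of them is only
known outside a short window. -/
lemma exists_gap {M : Type*} [MetricSpace M] {C : Set M} (hC : IsCompact C) {x y : M → ι → ℝ}
    (hx : Continuous x) (hy : Continuous y)
    (h : ∀ P ∈ C, ∀ l, Null l (x P) → Null l (y P) → l = 0) :
    ∃ g > 0, ∀ P ∈ C, ∀ l : ι → ℝ, ∀ c : ℝ, Null l (x P) →
      (∀ u : ℝ → ℝ, (∀ w, |w - c| ≤ g → u w = 0) → ∑ i, l i * u (y P i) = 0) → l = 0 := by
  classical
  by_contra! hcon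
  obtain ⟨R, hR⟩ := hC.exists_bound_of_continuousOn hy.continuousOn
  have key : ∀ n : ℕ, ∃ p : M × (ι → ℝ) × ℝ,
      p ∈ C ×ˢ Metric.sphere (0 : ι → ℝ) 1 ×ˢ Set.Icc (-R) R ∧ Null p.2.1 (x p.1) ∧
      ∀ u : ℝ → ℝ, (∀ w, |w - p.2.2| ≤ 2 * (1 / ((n : ℝ) + 1)) → u w = 0) →
        ∑ i, p.2.1 i * u (y p.1 i) = 0 := by
    intro n
    obtain ⟨P, hP, l, c, hlx, hly, hl⟩ := hcon (1 / ((n : ℝ) + 1)) (by positivity)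
    have hl0 : ‖l‖ ≠ 0 := norm_ne_zero_iff.2 hl
    obtain ⟨k, hk⟩ : ∃ k, ∀ u : ℝ → ℝ,
        (∀ w, |w - y P k| ≤ 2 * (1 / ((n : ℝ) + 1)) → u w = 0) → ∑ i, l i * u (y P i) = 0 := by
      by_cases hk : ∃ k, |y P k - c| ≤ 1 / ((n : ℝ) + 1)
      · obtain ⟨k, hk⟩ := hk
        refine ⟨k, fun u hu => hly u fun w hw => hu w ?_⟩
        calc |w - y P k| ≤ |w - c| + |c - y P k| := abs_sub_le _ _ _
          _ ≤ _ := by rw [abs_sub_comm c]; linarith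
      · obtain ⟨k, -⟩ := Function.ne_iff.1 hl
        refine ⟨k, fun u _ => ?_⟩
        have := hly (fun w => if |w - c| ≤ 1 / ((n : ℝ) + 1) then 0 else u w)
          (fun w hw => if_pos hw)
        rw [← this]
        exact Finset.sum_congr rfl fun i _ => by
          rw [if_neg fun hi => hk ⟨i, hi⟩]
    refine ⟨(P, ‖l‖⁻¹ • l, y P k), ⟨hP, ?_, ?_⟩, fun u => ?_, fun u hu => ?_⟩
    · simp [norm_smul, hl0]
    · exact abs_le.1 ((norm_le_pi_norm (y P) k).trans (hR P hP))
    · simp only [Pi.smul_apply, smul_eq_mul, mul_assoc, ← Finset.mul_sum, hlx u, mul_zero]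
    · simp only [Pi.smul_apply, smul_eq_mul, mul_assoc, ← Finset.mul_sum, hk u hu, mul_zero]
  choose p hpC hpx hpy using key
  obtain ⟨⟨P, l, c⟩, hmem, σ, hσ, ht⟩ :=
    (hC.prod ((isCompact_sphere (0 : ι → ℝ) 1).prod (isCompact_Icc (a := -R)
      (b := R)))).tendsto_subseq
      hpC
  have hP : Tendsto (fun n => (p (σ n)).1) atTop (𝓝 P) := (continuous_fst.tendsto _).comp ht
  have hl : Tendsto (fun n => (p (σ n)).2.1) atTop (𝓝 l) :=
    ((continuous_fst.comp continuous_snd).tendsto _).comp ht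
  have hc : Tendsto (fun n => (p (σ n)).2.2) atTop (𝓝 c) :=
    ((continuous_snd.comp continuous_snd).tendsto _).comp ht
  have hnx : Null l (x P) := null_of_fiber fun e =>
    sum_fiber_of_tendsto ((hx.tendsto P).comp hP) hl e
      (Eventually.of_forall fun η => Eventually.of_forall fun n =>
        hpx (σ n) fun w => if |w - e| < η then 1 else 0)
  have hny' : ∀ e ≠ c, ∑ i, l i * (if y P i = e then 1 else 0) = 0 := fun e he => by
    refine sum_fiber_of_tendsto ((hy.tendsto P).comp hP) hl e ?_
    have hpos : 0 < |e - c| := abs_pos.2 (sub_ne_zero.2 he)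
    filter_upwards [eventually_nhdsWithin_of_eventually_nhds
      (Iio_mem_nhds (show (0 : ℝ) < |e - c| / 3 by positivity))] with η hη
    have hη : η < |e - c| / 3 := hη
    have h1 : Tendsto (fun n => 2 * (1 / (((σ n : ℕ) : ℝ) + 1))) atTop (𝓝 (2 * 0)) :=
      (tendsto_one_div_add_atTop_nhds_zero_nat.comp hσ.tendsto_atTop).const_mul 2
    rw [mul_zero] at h1
    have h2 : Tendsto (fun n => |(p (σ n)).2.2 - c|) atTop (𝓝 |c - c|) := (hc.sub_const c).abs
    rw [sub_self, abs_zero] at h2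
    filter_upwards [h1.eventually (gt_mem_nhds (show (0 : ℝ) < |e - c| / 3 by positivity)),
      h2.eventually (gt_mem_nhds (show (0 : ℝ) < |e - c| / 3 by positivity))] with n hn1 hn2
    refine hpy (σ n) (fun w => if |w - e| < η then 1 else 0) fun w hw => if_neg fun hwe => ?_
    have h3 : |e - c| ≤ |w - e| + |w - (p (σ n)).2.2| + |(p (σ n)).2.2 - c| := by
      calc |e - c| ≤ |e - w| + |w - c| := abs_sub_le _ _ _
        _ ≤ |e - w| + (|w - (p (σ n)).2.2| + |(p (σ n)).2.2 - c|) := by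
          gcongr; exact abs_sub_le _ _ _
        _ = _ := by rw [abs_sub_comm e w]; ring
    linarith
  have hny : Null l (y P) := null_of_fiber fun e => by
    by_cases he : e = c
    · have h0 : ∑ i, l i = 0 := by simpa using hnx fun _ => 1
      have h1 : Null (fun i => l i * (if y P i = c then 0 else 1)) (y P) :=
        null_of_fiber fun e' => by
          by_cases he' : e' = c
          · exact Finset.sum_eq_zero fun i _ => by split_ifs <;> simp_all
          · rw [← hny' e' he']
            exact Finset.sum_congr rfl fun i _ => by split_ifs <;> simp_all
      have h2 := h1 fun _ => 1
      have h3 : ∑ i, l i * (if y P i = c then 1 else 0) +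
          ∑ i, l i * (if y P i = c then 0 else 1) * 1 = ∑ i, l i := by
        rw [← Finset.sum_add_distrib]
        exact Finset.sum_congr rfl fun i _ => by split_ifs <;> simp
      rw [he]
      linarith
    · exact hny' e he
  have := h P hmem.1 l hnx hny
  have h1 : ‖l‖ = 1 := by simpa using hmem.2.1
  simp [this] at h1

end Null

section Flexible

lemma rename_rename_self {V : Type*} {τ : V → V} (hτ : Function.Involutive τ) (p : Chains V) :
    rename τ (rename τ p) = p := by
  rw [rename_rename, hτ.comp_self, rename_id_apply]

lemma bd_top {V : Type*} {τ : V → V} (hτ : Function.Involutive τ) {h : ℕ → Chains V} {q : ℕ}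
    (h0 : bd (h 0) = 1) (hs : ∀ j < q, bd (h (j + 1)) = h j + rename τ (h j)) :
    bd (h q + rename τ (h q)) = 0 := by
  rw [map_add, bd_rename]
  rcases q with _ | q
  · rw [h0, map_one, add_self_chain]
  · rw [hs q q.lt_succ_self, map_add, rename_rename_self hτ, add_comm (rename τ (h q)),
      add_self_chain]

lemma joinSeq_mem {V : Type*} {τ : V → V} {S S' U : Set (Multiset V)} {q q' : ℕ}
    {h h' : ℕ → Chains V} (hm : ∀ j ≤ q, h j ∈ chainsOn {s | s ∈ S ∧ s.card = j + 1})
    (hm' : ∀ j ≤ q', h' j ∈ chainsOn {s | s ∈ S' ∧ s.card = j + 1})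
    (hτS : ∀ s ∈ S, s.map τ ∈ S) (h1 : S ⊆ U) (h2 : ∀ s ∈ S, ∀ t ∈ S', s + t ∈ U) {j : ℕ}
    (hj : j ≤ q + q' + 1) :
    joinSeq (rename τ : Chains V →ₐ[ZMod 2] Chains V).toRingHom q h h' j ∈
      chainsOn {s | s ∈ U ∧ s.card = j + 1} := by
  unfold joinSeq
  split_ifs with hjq
  · exact chainsOn_mono (fun s hs => And.imp_left (@h1 s) hs) (hm j hjq)
  · refine mul_mem_chainsOn (S := {s | s ∈ S ∧ s.card = q + 1})
      (T := {s | s ∈ S' ∧ s.card = j - (q + 1) + 1}) (fun s hs t ht => ?_)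
      (Submodule.add_mem _ (hm q le_rfl) ?_) (hm' _ (by omega))
    · refine ⟨h2 s hs.1 t ht.1, ?_⟩
      rw [Multiset.card_add, hs.2, ht.2]; omega
    · refine rename_mem τ (S := {s | s ∈ S ∧ s.card = q + 1}) (fun s hs => ?_) (hm q le_rfl)
      exact ⟨hτS s hs.1, by simpa using hs.2⟩

lemma HasHemispheres.join {V : Type*} {τ : V → V} (hτ : Function.Involutive τ)
    {S S' U : Set (Multiset V)} {q q' : ℕ} (H : HasHemispheres τ S q)
    (H' : HasHemispheres τ S' q') (hτS : ∀ s ∈ S, s.map τ ∈ S) (h1 : S ⊆ U)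
    (h2 : ∀ s ∈ S, ∀ t ∈ S', s + t ∈ U) : HasHemispheres τ U (q + q' + 1) := by
  obtain ⟨h, h0, hs, hm⟩ := H
  obtain ⟨h', h0', hs', hm'⟩ := H'
  refine ⟨joinSeq (rename τ : Chains V →ₐ[ZMod 2] Chains V).toRingHom q h h', ?_,
    fun j hj => ?_, fun j hj => joinSeq_mem hm hm' hτS h1 h2 hj⟩
  · simp [joinSeq, h0]
  · exact d_joinSeq (d := (bd : Derivation (ZMod 2) (Chains V) (Chains V)).toLinearMap.toAddMonoidHom)
      bd_mul (rename_rename_self hτ) h0' hs (bd_top hτ h0 hs) hs' hj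

lemma HasHemispheres.nonempty {V : Type*} {τ : V → V} {S : Set (Multiset V)} {q : ℕ}
    (H : HasHemispheres τ S q) : S.Nonempty := by
  obtain ⟨h, h0, -, hm⟩ := H
  by_contra hS
  rw [Set.not_nonempty_iff_eq_empty] at hS
  have := hm 0 (Nat.zero_le _)
  simp only [hS, Set.mem_empty_iff_false, false_and, Set.ofPred_false, chainsOn,
    Set.image_empty, Submodule.span_empty, Submodule.mem_bot] at this
  simp [this] at h0

variable {ι κ : Type*} {E : Type*} [NormedAddCommGroup E] [NormedSpace ℝ E]

/-- The convex hull of the `ε`-balls about the points `± φ (P i)`, with signs `s`. -/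
def tube (φ : ℝ × ℝ → E) (P : ι → ℝ × ℝ) (s : ι → ℝ) (ε : ℝ) : Set E :=
  convexHull ℝ {v | ∃ i, ‖v - s i • φ (P i)‖ ≤ ε}

/-- Simplices contained in one of the tubes of the configurations in `C`. -/
def carried (C : Set (ι → ℝ × ℝ)) (φ : ℝ × ℝ → E) (ε : ℝ) : Set (Multiset E) :=
  {m | ∃ P ∈ C, ∃ s : ι → ℝ, (∀ i, |s i| = 1) ∧ ∀ v ∈ m, v ∈ tube φ P s ε}

lemma map_mem_tube {F : Type*} [NormedAddCommGroup F] [NormedSpace ℝ F] (f : E →ₗ[ℝ] F)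
    {φ : ℝ × ℝ → E} {ψ : ℝ × ℝ → F} {P : ι → ℝ × ℝ} {Q : κ → ℝ × ℝ} {s : ι → ℝ} {t : κ → ℝ}
    {ε δ : ℝ} (h : ∀ v i, ‖v - s i • φ (P i)‖ ≤ ε → ∃ j, ‖f v - t j • ψ (Q j)‖ ≤ δ) {v : E}
    (hv : v ∈ tube φ P s ε) : f v ∈ tube ψ Q t δ := by
  have : f '' convexHull ℝ {v | ∃ i, ‖v - s i • φ (P i)‖ ≤ ε} ⊆ tube ψ Q t δ := by
    rw [LinearMap.image_convexHull]
    refine convexHull_mono ?_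
    rintro _ ⟨v, ⟨i, hi⟩, rfl⟩
    exact h v i hi
  exact this ⟨v, hv, rfl⟩

lemma neg_mem_carried {C : Set (ι → ℝ × ℝ)} {φ : ℝ × ℝ → E} {ε : ℝ} {m : Multiset E}
    (hm : m ∈ carried C φ ε) : m.map Neg.neg ∈ carried C φ ε := by
  obtain ⟨P, hP, s, hs, h⟩ := hm
  refine ⟨P, hP, -s, by simpa using hs, fun v hv => ?_⟩
  obtain ⟨w, hw, rfl⟩ := Multiset.mem_map.1 hv
  refine map_mem_tube (-LinearMap.id : E →ₗ[ℝ] E) (fun v i hi => ⟨i, ?_⟩) (h w hw)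
  have : (-LinearMap.id : E →ₗ[ℝ] E) v - (-s) i • φ (P i) = -(v - s i • φ (P i)) := by
    simp; abel
  rwa [this, norm_neg]

lemma eq_zero_of_inl_inr {l : ι ⊕ κ → ℝ} (h1 : l ∘ Sum.inl = 0) (h2 : l ∘ Sum.inr = 0) :
    l = 0 := by
  ext (i | i)
  · exact congrFun h1 i
  · exact congrFun h2 i

variable [Fintype ι] [Fintype κ]

/-- The family of chords given by the configuration, after all right end points are moved far to
the right, is linearly independent. -/
def Nonresonant (P : ι → ℝ × ℝ) : Prop :=
  ∀ l : ι → ℝ, Null l (fun i => (P i).1) → Null l (fun i => (P i).2) → l = 0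

variable (ι) in
/-- There is a compact family of nonresonant configurations carrying a `q`-sphere of signed
convex combinations, for every continuous map of the plane to a normed space. -/
def Flexible (q : ℕ) : Prop :=
  ∃ C : Set (ι → ℝ × ℝ), IsCompact C ∧ (∀ P ∈ C, Nonresonant P) ∧
    ∀ (E : Type) [NormedAddCommGroup E] [NormedSpace ℝ E] (φ : C(ℝ × ℝ, E)) (ε : ℝ), 0 < ε →
      HasHemispheres (Neg.neg : E → E) (carried C φ ε) q

lemma flexible_unit : Flexible Unit 0 := by
  refine ⟨{0}, isCompact_singleton, ?_, fun E _ _ φ ε hε => ?_⟩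
  · rintro P - l hl -
    ext i
    simpa using hl fun _ => 1
  · refine ⟨fun _ => X (φ 0), by simp, by simp, fun j hj => ?_⟩
    obtain rfl : j = 0 := by omega
    refine (by simp [simplex] : simplex {φ 0} = (X (φ 0) : Chains E)) ▸ simplex_mem ⟨?_, by simp⟩
    refine ⟨0, rfl, 1, by simp, fun v hv => ?_⟩
    obtain rfl := Multiset.mem_singleton.1 hv
    exact subset_convexHull ℝ _ ⟨(), by simpa using hε.le⟩

lemma Flexible.congr {q : ℕ} (e : ι ≃ κ) (h : Flexible ι q) : Flexible κ q := by
  obtain ⟨C, hC, hn, hh⟩ := h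
  refine ⟨(fun P => P ∘ e.symm) '' C, hC.image (by fun_prop), ?_, fun E _ _ φ ε hε => ?_⟩
  · rintro _ ⟨P, hP, rfl⟩ l h1 h2
    have := hn P hP (l ∘ e) (fun u => ?_) (fun u => ?_)
    · ext i
      simpa using congrFun this (e.symm i)
    · rw [← h1 u]
      exact Fintype.sum_equiv e _ _ (by simp)
    · rw [← h2 u]
      exact Fintype.sum_equiv e _ _ (by simp)
  · refine (hh E φ ε hε).map id (by simp) fun m hm => ?_
    obtain ⟨P, hP, s, hs, hm⟩ := hm
    refine ⟨_, ⟨P, hP, rfl⟩, s ∘ e.symm, fun i => hs _, fun v hv => ?_⟩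
    rw [Multiset.map_id] at hv
    exact map_mem_tube LinearMap.id (fun v i hi => ⟨e i, by simpa using hi⟩) (hm v hv)

lemma exists_coord_bound {C : Set (ι → ℝ × ℝ)} (hC : IsCompact C) :
    ∃ R : ℝ, 1 ≤ R ∧ ∀ P ∈ C, ∀ i, |(P i).1| ≤ R ∧ |(P i).2| ≤ R := by
  obtain ⟨R, hR⟩ := hC.exists_bound_of_continuousOn continuousOn_id
  refine ⟨max 1 R, le_max_left _ _, fun P hP i => ?_⟩
  have h := ((norm_le_pi_norm P i).trans (hR P hP)).trans (le_max_right 1 R)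
  exact ⟨(norm_fst_le _).trans h, (norm_snd_le _).trans h⟩

lemma Flexible.join {q q' : ℕ} (H : Flexible ι q) (H' : Flexible κ q') :
    Flexible (ι ⊕ κ) (q + q' + 1) := by
  obtain ⟨C, hC, hn, hh⟩ := H
  obtain ⟨C', hC', hn', hh'⟩ := H'
  obtain ⟨R, hR1, hR⟩ := exists_coord_bound hC
  obtain ⟨R', hR1', hR'⟩ := exists_coord_bound hC'
  set L : ℝ := R + R' + 1
  let f : (ι → ℝ × ℝ) × (κ → ℝ × ℝ) → ι ⊕ κ → ℝ × ℝ :=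
    fun p => Sum.elim p.1 fun j => p.2 j + (L, L)
  have hf : Continuous f := by
    refine continuous_pi fun i => ?_
    rcases i with i | i <;> simp only [f, Sum.elim_inl, Sum.elim_inr] <;> fun_prop
  refine ⟨f '' (C ×ˢ C'), (hC.prod hC').image hf, ?_, fun E _ _ φ ε hε => ?_⟩
  · rintro _ ⟨⟨P, P'⟩, ⟨hP, hP'⟩, rfl⟩ l h1 h2
    replace h1 : Null l (Sum.elim (fun i => (P i).1) fun j => L + 1 * (P' j).1) := by
      convert h1 using 1
      ext (i | i) <;> simp [f, add_comm]
    replace h2 : Null l (Sum.elim (fun i => (P i).2) fun j => L + 1 * (P' j).2) := by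
      convert h2 using 1
      ext (i | i) <;> simp [f, add_comm]
    have d1 : ∀ i j, (P i).1 ≠ L + 1 * (P' j).1 := fun i j h => by
      have h3 := abs_le.1 (hR P hP i).1
      have h4 := abs_le.1 (hR' P' hP' j).1
      simp only [L] at h; linarith
    have d2 : ∀ i j, (P i).2 ≠ L + 1 * (P' j).2 := fun i j h => by
      have h3 := abs_le.1 (hR P hP i).2
      have h4 := abs_le.1 (hR' P' hP' j).2
      simp only [L] at h; linarith
    exact eq_zero_of_inl_inr (hn P hP _ (h1.left d1) (h2.left d2))
      (hn' P' hP' _ ((h1.right d1).of_affine one_ne_zero) ((h2.right d2).of_affine one_ne_zero))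
  · have h1 := hh E φ ε hε
    have h2 := hh' E (φ.comp ⟨fun p => p + (L, L), by fun_prop⟩) ε hε
    obtain ⟨-, P₀, hP₀, -⟩ := h2.nonempty
    refine h1.join neg_involutive h2 (fun _ => neg_mem_carried) ?_ ?_
    · rintro m ⟨P, hP, s, hs, hm⟩
      refine ⟨_, ⟨(P, P₀), ⟨hP, hP₀⟩, rfl⟩, Sum.elim s 1, ?_, fun v hv => ?_⟩
      · rintro (i | i) <;> simp [hs]
      · exact map_mem_tube LinearMap.id (fun v i hi => ⟨Sum.inl i, by simpa [f] using hi⟩) (hm v hv)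
    · rintro m ⟨P, hP, s, hs, hm⟩ m' ⟨P', hP', s', hs', hm'⟩
      refine ⟨_, ⟨(P, P'), ⟨hP, hP'⟩, rfl⟩, Sum.elim s s', ?_, fun v hv => ?_⟩
      · rintro (i | i) <;> simp [hs, hs']
      · rcases Multiset.mem_add.1 hv with hv | hv
        · exact map_mem_tube LinearMap.id (fun v i hi => ⟨Sum.inl i, by simpa [f] using hi⟩)
            (hm v hv)
        · exact map_mem_tube LinearMap.id (fun v i hi => ⟨Sum.inr i, by simpa [f] using hi⟩)
            (hm' v hv)

end Flexible

section Swap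

variable {V W : Type*}

lemma map_joinSeq {A : Type*} [CommRing A] {T : A →+* A} (q : ℕ) (h h' : ℕ → A) (f : A →+* A)
    (hf : ∀ x, f (T x) = T (f x)) (j : ℕ) :
    f (joinSeq T q h h' j) = joinSeq T q (fun j => f (h j)) (fun j => f (h' j)) j := by
  unfold joinSeq
  split_ifs <;> simp [hf]

lemma swapSeq_mem {τ : V → V} {S S' U : Set (Multiset V)} {h h' : ℕ → Chains V}
    (hm : ∀ j, h j ∈ chainsOn {s | s ∈ S ∧ s.card = j + 1})
    (hm' : ∀ j, h' j ∈ chainsOn {s | s ∈ S' ∧ s.card = j + 1})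
    (hτS : ∀ s ∈ S, s.map τ ∈ S) (h1 : S ⊆ U) (h2 : ∀ s ∈ S, ∀ t ∈ S', s + t ∈ U) (j : ℕ) :
    swapSeq (rename τ : Chains V →ₐ[ZMod 2] Chains V).toRingHom h h' j ∈
      chainsOn {s | s ∈ U ∧ s.card = j + 1} := by
  have hU : ∀ j, h j ∈ chainsOn {s | s ∈ U ∧ s.card = j + 1} := fun j =>
    chainsOn_mono (fun s hs => And.imp_left (@h1 s) hs) (hm j)
  rcases j with _ | j
  · exact hU 0
  · rw [swapSeq]
    refine Submodule.add_mem _ (Submodule.sum_mem _ fun p hp => ?_) ?_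
    · refine mul_mem_chainsOn (S := {s | s ∈ S ∧ s.card = p.1 + 1})
        (T := {s | s ∈ S' ∧ s.card = p.2 + 1}) (fun s hs t ht => ?_) ?_ (hm' _)
      · refine ⟨h2 s hs.1 t ht.1, ?_⟩
        rw [Multiset.card_add, hs.2, ht.2, ← Finset.HasAntidiagonal.mem_antidiagonal.1 hp]; omega
      · unfold twist
        split_ifs
        · refine rename_mem τ (S := {s | s ∈ S ∧ s.card = p.1 + 1}) (fun s hs => ?_) (hm _)
          exact ⟨hτS s hs.1, by simpa using hs.2⟩
        · exact hm _
    · split_ifs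
      · exact hU _
      · exact zero_mem _

/-- The join of an even dimensional sphere with itself, completed by a homotopy between the
identity and the exchange of the two factors. -/
lemma HasHemispheres.swap {τ : V → V} {σ : W → W} (hτ : Function.Involutive τ)
    {S : Set (Multiset V)} {U : Set (Multiset (V ⊕ V))} {S' : Set (Multiset W)} {q : ℕ}
    (H : HasHemispheres τ S q) (hq : Even q) (hτS : ∀ s ∈ S, s.map τ ∈ S)
    (hU : ∀ s ∈ S, s.map Sum.inl ∈ U)
    (hU' : ∀ s ∈ S, ∀ t ∈ S, s.map Sum.inl + t.map Sum.inr ∈ U)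
    {Ψ : V ⊕ V → W} (hΨ : ∀ x, Ψ (Sum.map τ τ x) = σ (Ψ x)) (hΨU : ∀ s ∈ U, s.map Ψ ∈ S')
    {D : Chains (V ⊕ V) →ₗ[ZMod 2] Chains W}
    (hD1 : D 1 = 0)
    (hD : ∀ p, bd (D p) = rename Ψ p + rename (Ψ ∘ Sum.swap) p + D (bd p))
    (hDτ : ∀ p, D (rename (Sum.map τ τ) p) = rename σ (D p))
    (hDU : ∀ s ∈ U, D (simplex s) ∈ chainsOn {t | t ∈ S' ∧ t.card = s.card + 1}) :
    HasHemispheres σ S' (2 * q + 2) := by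
  obtain ⟨h₀, h0, hs, hm⟩ := H
  have hT : Function.Involutive (Sum.map τ τ) := fun x => by
    rcases x with x | x <;> simp [hτ x]
  set T := (rename (Sum.map τ τ) : Chains (V ⊕ V) →ₐ[ZMod 2] Chains (V ⊕ V)).toRingHom
  let e : (V → V ⊕ V) → ℕ → Chains (V ⊕ V) := fun i j => if j ≤ q then rename i (h₀ j) else 0
  have ecomm : ∀ i : V → V ⊕ V, (∀ v, i (τ v) = Sum.map τ τ (i v)) → ∀ p,
      rename i (rename τ p) = T (rename i p) := fun i hi p => by
    change _ = rename _ _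
    rw [rename_rename, rename_rename]
    congr 2
    exact funext hi
  have he0 : ∀ i, bd (e i 0) = 1 := fun i => by simp [e, bd_rename, h0]
  have heq : ∀ i j, q < j → e i j = 0 := fun i j hj => if_neg (by omega)
  have hes : ∀ i : V → V ⊕ V, (∀ v, i (τ v) = Sum.map τ τ (i v)) → ∀ j,
      bd (e i (j + 1)) = e i j + T (e i j) + if j = q then e i q + T (e i q) else 0 := by
    intro i hi j
    rcases lt_trichotomy j q with hj | rfl | hj
    · rw [if_neg hj.ne, add_zero]
      simp only [e]
      rw [if_pos (by omega), if_pos (by omega), bd_rename, hs j hj, map_add, ecomm i hi]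
    · rw [if_pos rfl, add_self_chain]
      simp [e]
    · rw [if_neg hj.ne', heq i _ (by omega), heq i j hj]
      simp
  have hes' : ∀ i : V → V ⊕ V, (∀ v, i (τ v) = Sum.map τ τ (i v)) → ∀ j < q,
      bd (e i (j + 1)) = e i j + T (e i j) := fun i hi j hj => by
    rw [hes i hi, if_neg hj.ne, add_zero]
  have hem : ∀ (i : V → V ⊕ V) j, e i j ∈
      chainsOn {s | s ∈ Multiset.map i '' S ∧ s.card = j + 1} := fun i j => by
    simp only [e]
    split_ifs with hj
    · refine rename_mem i (S := {s | s ∈ S ∧ s.card = j + 1}) (fun s hs => ?_) (hm j hj)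
      exact ⟨⟨s, hs.1, rfl⟩, by simpa using hs.2⟩
    · exact zero_mem _
  have hl : ∀ v, (Sum.inl (τ v) : V ⊕ V) = Sum.map τ τ (Sum.inl v) := fun _ => rfl
  have hr : ∀ v, (Sum.inr (τ v) : V ⊕ V) = Sum.map τ τ (Sum.inr v) := fun _ => rfl
  have cond1 : ∀ s ∈ Multiset.map (Sum.inl : V → V ⊕ V) '' S,
      s.map (Sum.map τ τ) ∈ Multiset.map (Sum.inl : V → V ⊕ V) '' S := by
    rintro _ ⟨s, hs, rfl⟩
    exact ⟨_, hτS s hs, by simp [Multiset.map_map, Function.comp_def]⟩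
  have cond2 : Multiset.map (Sum.inl : V → V ⊕ V) '' S ⊆ U := by
    rintro _ ⟨s, hs, rfl⟩
    exact hU s hs
  have cond3 : ∀ s ∈ Multiset.map (Sum.inl : V → V ⊕ V) '' S,
      ∀ t ∈ Multiset.map (Sum.inr : V → V ⊕ V) '' S, s + t ∈ U := by
    rintro _ ⟨s, hs, rfl⟩ _ ⟨t, ht, rfl⟩
    exact hU' s hs t ht
  set G := joinSeq T q (e Sum.inl) (e Sum.inr)
  set G' := joinSeq T q (e Sum.inr) (e Sum.inl)
  set R := swapSeq T (e Sum.inl) (e Sum.inr)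
  have hG : ∀ j < q + q + 1, bd (G (j + 1)) = G j + rename (Sum.map τ τ) (G j) := fun j hj =>
    d_joinSeq (d := (bd : Derivation (ZMod 2) (Chains (V ⊕ V))
      (Chains (V ⊕ V))).toLinearMap.toAddMonoidHom) (T := T)
      bd_mul (rename_rename_self hT) (he0 _) (hes' _ hl)
      (bd_top hT (he0 _) (hes' _ hl)) (hes' _ hr) hj
  have hG0 : bd (G 0) = 1 := by simp [G, joinSeq, he0]
  have hGG : ∀ j, rename Sum.swap (G j) = G' j := fun j => by
    refine (map_joinSeq q _ _ (rename Sum.swap : Chains (V ⊕ V) →ₐ[ZMod 2] Chains (V ⊕ V)).toRingHom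
      (fun x => ?_) j).trans ?_
    · change rename _ (rename _ x) = rename _ (rename _ x)
      rw [rename_rename, rename_rename]
      congr 2
      ext (v | v) <;> rfl
    · have : ∀ i : V → V ⊕ V, (fun j => (rename Sum.swap : Chains (V ⊕ V) →ₐ[ZMod 2]
          Chains (V ⊕ V)).toRingHom (e i j)) = e (Sum.swap ∘ i) := fun i => by
        ext1 j
        change rename _ _ = _
        simp only [e]
        split_ifs <;> simp [rename_rename]
      rw [this, this]
      rfl
  have hR : ∀ j, bd (R (j + 1)) + (G j + G' j) = R j + rename (Sum.map τ τ) (R j) := fun j =>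
    d_swapSeq (d := (bd : Derivation (ZMod 2) (Chains (V ⊕ V))
      (Chains (V ⊕ V))).toLinearMap.toAddMonoidHom) (T := T)
      bd_mul (bd_rename _) (rename_rename_self hT) (he0 _) (he0 _) hq (heq _) (heq _)
      (hes _ hl) (hes _ hr) j
  have hΨT : ∀ p : Chains (V ⊕ V), rename Ψ (rename (Sum.map τ τ) p) =
      rename σ (rename Ψ p) := fun p => by
    rw [rename_rename, rename_rename]
    congr 2
    exact funext hΨ
  have hDG : ∀ j < 2 * q + 2, bd (D (G j)) =
      rename Ψ (G j + G' j) + if j = 0 then 0 else D (G (j - 1)) + rename σ (D (G (j - 1))) := by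
    intro j hj
    rw [hD, map_add, ← hGG, rename_rename]
    congr 1
    rcases j with _ | j
    · rw [hG0, hD1, if_pos rfl]
    · rw [hG j (by omega), map_add, hDτ, if_neg j.succ_ne_zero, Nat.add_sub_cancel]
  refine ⟨fun j => rename Ψ (R j) + if j = 0 then 0 else D (G (j - 1)), ?_, fun j hj => ?_,
    fun j hj => ?_⟩
  · simp [R, swapSeq, bd_rename, he0]
  · beta_reduce
    rw [if_neg j.succ_ne_zero, Nat.add_sub_cancel, map_add, bd_rename, hDG j hj, ← add_assoc,
      ← map_add, hR, map_add, hΨT]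
    split_ifs
    · simp
    · rw [map_add]; ring
  · refine Submodule.add_mem _ (rename_mem Ψ (S := {s | s ∈ U ∧ s.card = j + 1})
      (fun s hs => And.intro (hΨU s hs.1) (by simpa using hs.2))
      (swapSeq_mem (hem _) (hem _) cond1 cond2 cond3 j)) ?_
    split_ifs with h0
    · exact zero_mem _
    · refine map_mem_of_simplex (S := {s | s ∈ U ∧ s.card = j - 1 + 1}) D (fun s hs => ?_)
        (joinSeq_mem (q' := q) (fun j _ => hem _ j) (fun j _ => hem _ j) cond1 cond2 cond3 (by omega))
      have := hDU s hs.1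
      rwa [hs.2, show j - 1 + 1 + 1 = j + 1 by omega] at this

end Swap

section Homotopy

variable {V E : Type*} [NormedAddCommGroup E]

/-- An equivariant chain homotopy between the chain maps induced by `Ψ` and `Ψ'`, which takes the
simplices in `U` to chains in `S`. -/
def Homotopic (τ : V → V) (U : Set (Multiset V)) (S : Set (Multiset E)) (Ψ Ψ' : V → E) : Prop :=
  ∃ D : Chains V →ₗ[ZMod 2] Chains E, D 1 = 0 ∧
    (∀ p, bd (D p) = rename Ψ p + rename Ψ' p + D (bd p)) ∧
    (∀ p, D (rename τ p) = rename Neg.neg (D p)) ∧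
    ∀ s ∈ U, D (simplex s) ∈ chainsOn {t | t ∈ S ∧ t.card = s.card + 1}

variable {τ : V → V} {U : Set (Multiset V)} {S : Set (Multiset E)} {Ψ Ψ' Ψ'' : V → E}

lemma Homotopic.symm (h : Homotopic τ U S Ψ Ψ') : Homotopic τ U S Ψ' Ψ := by
  obtain ⟨D, h1, hD, hτ, hU⟩ := h
  exact ⟨D, h1, fun p => by rw [hD, add_comm (rename Ψ p)], hτ, hU⟩

lemma Homotopic.trans (h : Homotopic τ U S Ψ Ψ') (h' : Homotopic τ U S Ψ' Ψ'') :
    Homotopic τ U S Ψ Ψ'' := by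
  obtain ⟨D, h1, hD, hτ, hU⟩ := h
  obtain ⟨D', h1', hD', hτ', hU'⟩ := h'
  refine ⟨D + D', by simp [h1, h1'], fun p => ?_, fun p => ?_, fun s hs =>
    Submodule.add_mem _ (hU s hs) (hU' s hs)⟩
  · rw [LinearMap.add_apply, LinearMap.add_apply, map_add, hD, hD']
    linear_combination add_self_chain (rename Ψ' p)
  · rw [LinearMap.add_apply, LinearMap.add_apply, map_add, hτ, hτ']

variable [NormedSpace ℝ E]

lemma homotopic_of_hull (hΨ : ∀ x, Ψ (τ x) = -Ψ x) (hΨ' : ∀ x, Ψ' (τ x) = -Ψ' x)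
    (h : ∀ s ∈ U, ∀ t : Multiset E, (∀ x ∈ t, x ∈ hull (s.map Ψ + s.map Ψ')) → t ∈ S) :
    Homotopic τ U S Ψ Ψ' := by
  classical
  let θ : Chains V →ₗ[ZMod 2] Chains E :=
    (rename Ψ : Chains V →ₐ[ZMod 2] Chains E).toLinearMap +
      (rename Ψ' : Chains V →ₐ[ZMod 2] Chains E).toLinearMap
  have hθ : ∀ p, θ p = rename Ψ p + rename Ψ' p := fun p => rfl
  let b : Multiset V → E := fun s => barycenter (s.map Ψ + s.map Ψ')
  have hb : ∀ s, s ≠ 0 → b s ∈ hull (s.map Ψ + s.map Ψ') := fun s hs =>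
    barycenter_mem (by simpa using hs) (convex_convexHull ℝ _) fun x hx => mem_hull hx
  refine ⟨cone b θ 0, by simp, fun p => ?_, fun p => ?_, fun s hs => ?_⟩
  · rw [bd_cone b θ 0 (fun p => by simp [hθ, bd_rename]) (by simp [hθ, add_self_chain]), hθ]
  · refine cone_rename b θ 0 (fun s => ?_) (fun p => ?_) (by simp) p
    · simp only [b]
      rw [← barycenter_neg, Multiset.map_add]
      simp only [Multiset.map_map, Function.comp_def, hΨ, hΨ']
    · rw [hθ, hθ, map_add, rename_rename, rename_rename, rename_rename, rename_rename,
        show Ψ ∘ τ = Neg.neg ∘ Ψ from funext hΨ, show Ψ' ∘ τ = Neg.neg ∘ Ψ' from funext hΨ']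
  · have := cone_simplex_mem b θ 0 (Q := fun s =>
      {t | t.card = s.card + 1 ∧ ∀ x ∈ t, x ∈ hull (s.map Ψ + s.map Ψ')}) (zero_mem _) ?_ ?_ s
    · exact chainsOn_mono (fun t ht => And.intro (h s hs t ht.2) ht.1) this
    · intro s hs
      rw [hθ, rename_simplex, rename_simplex]
      refine Submodule.add_mem _ (simplex_mem ⟨by simp, fun x hx => ?_⟩)
        (simplex_mem ⟨by simp, fun x hx => ?_⟩)
      · rcases Multiset.mem_cons.1 hx with rfl | hx
        · exact hb s hs
        · exact mem_hull (Multiset.mem_add.2 (Or.inl hx))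
      · rcases Multiset.mem_cons.1 hx with rfl | hx
        · exact hb s hs
        · exact mem_hull (Multiset.mem_add.2 (Or.inr hx))
    · rintro s v hv t ⟨ht1, ht2⟩
      refine ⟨?_, fun x hx => ?_⟩
      · rw [Multiset.card_cons, ht1, Multiset.card_erase_add_one hv]
      · rcases Multiset.mem_cons.1 hx with rfl | hx
        · exact hb s (by rintro rfl; simp at hv)
        · refine hull_mono (fun y hy => mem_hull ?_) (ht2 x hx)
          have hle := Multiset.erase_le v s
          exact Multiset.mem_of_le
            (add_le_add (Multiset.map_le_map hle) (Multiset.map_le_map hle)) hy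

end Homotopy

section Move

open Topology Filter

variable {ι : Type*} {K : Type} [TopologicalSpace K] [CompactSpace K] [InvolutiveNeg K]
  [ContinuousNeg K]

/-- The configurations obtained by moving two configurations in opposite directions. -/
def moved (f : K × (ℝ × ℝ) → ℝ × ℝ) (C : Set (ι → ℝ × ℝ)) : Set (ι ⊕ ι → ℝ × ℝ) :=
  {Q | ∃ z, ∃ P ∈ C, ∃ P' ∈ C, Q = Sum.elim (fun i => f (z, P i)) fun i => f (-z, P' i)}

lemma isCompact_moved (f : C(K × (ℝ × ℝ), ℝ × ℝ)) {C : Set (ι → ℝ × ℝ)} (hC : IsCompact C) :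
    IsCompact (moved f C) := by
  let F : K × (ι → ℝ × ℝ) × (ι → ℝ × ℝ) → ι ⊕ ι → ℝ × ℝ := fun p =>
    Sum.elim (fun i => f (p.1, p.2.1 i)) fun i => f (-p.1, p.2.2 i)
  have hF : Continuous F := by
    refine continuous_pi fun i => ?_
    rcases i with i | i <;> simp only [F, Sum.elim_inl, Sum.elim_inr] <;> fun_prop
  convert (isCompact_univ.prod (hC.prod hC)).image hF
  ext Q
  constructor
  · rintro ⟨z, P, hP, P', hP', rfl⟩
    exact ⟨(z, P, P'), ⟨trivial, hP, hP'⟩, rfl⟩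
  · rintro ⟨⟨z, P, P'⟩, ⟨-, hP, hP'⟩, rfl⟩
    exact ⟨z, P, hP, P', hP', rfl⟩

variable [Fintype ι] [PreconnectedSpace K] [Nonempty K]

lemma hasHemispheres_moved {C : Set (ι → ℝ × ℝ)} (hC : IsCompact C) {q : ℕ} (hq : Even q)
    (hh : ∀ (E : Type) [NormedAddCommGroup E] [NormedSpace ℝ E] (φ : C(ℝ × ℝ, E)) (ε : ℝ), 0 < ε →
      HasHemispheres (Neg.neg : E → E) (carried C φ ε) q)
    (f : C(K × (ℝ × ℝ), ℝ × ℝ)) (E : Type) [NormedAddCommGroup E] [NormedSpace ℝ E]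
    (φ : C(ℝ × ℝ, E)) {ε : ℝ} (hε : 0 < ε) :
    HasHemispheres (Neg.neg : E → E) (carried (moved f C) φ ε) (2 * q + 2) := by
  let φ' : C(ℝ × ℝ, C(K, E)) := ((φ.comp f).comp ContinuousMap.prodSwap).curry
  have hφ' : ∀ p z, φ' p z = φ (f (z, p)) := fun p z => rfl
  have H := hh C(K, E) φ' (ε / 2) (by positivity)
  obtain ⟨-, P₀, hP₀, -⟩ := H.nonempty
  let ev : K → C(K, E) →ₗ[ℝ] E := fun z =>
    { toFun := fun v => v z, map_add' := fun _ _ => rfl, map_smul' := fun _ _ => rfl }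
  let Ψ : K → C(K, E) ⊕ C(K, E) → E := fun z => Sum.elim (ev z) (ev (-z))
  let τ : C(K, E) ⊕ C(K, E) → C(K, E) ⊕ C(K, E) := Sum.map Neg.neg Neg.neg
  let U : Set (Multiset (C(K, E) ⊕ C(K, E))) := {m | ∃ P ∈ C, ∃ P' ∈ C, ∃ s s' : ι → ℝ,
    (∀ i, |s i| = 1) ∧ (∀ i, |s' i| = 1) ∧ (∀ v, Sum.inl v ∈ m → v ∈ tube φ' P s (ε / 2)) ∧
    ∀ v, Sum.inr v ∈ m → v ∈ tube φ' P' s' (ε / 2)}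
  have hΨ : ∀ z x, Ψ z (τ x) = -Ψ z x := by
    rintro z (x | x) <;> rfl
  have close : ∀ z w, (∀ P ∈ C, ∀ i, ‖φ (f (w, P i)) - φ (f (z, P i))‖ ≤ ε / 2) →
      ∀ P ∈ C, ∀ s : ι → ℝ, (∀ i, |s i| = 1) → ∀ v ∈ tube φ' P s (ε / 2), ∀ Q : ι ⊕ ι → ℝ × ℝ,
      ∀ t : ι ⊕ ι → ℝ, ∀ e : ι → ι ⊕ ι, (∀ i, Q (e i) = f (z, P i)) → (∀ i, t (e i) = s i) →
      v w ∈ tube φ Q t ε := by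
    intro z w hzw P hP s hs v hv Q t e hQ ht
    refine map_mem_tube (ev w) (fun v i hi => ⟨e i, ?_⟩) hv
    rw [hQ, ht]
    have h1 : ‖v w - s i • φ (f (w, P i))‖ ≤ ε / 2 :=
      (ContinuousMap.norm_coe_le_norm (v - s i • φ' (P i)) w).trans hi
    have h2 : ‖s i • φ (f (w, P i)) - s i • φ (f (z, P i))‖ ≤ ε / 2 := by
      rw [← smul_sub, norm_smul, Real.norm_eq_abs, hs, one_mul]
      exact hzw P hP i
    calc ‖v w - s i • φ (f (z, P i))‖
        ≤ ‖v w - s i • φ (f (w, P i))‖ + ‖s i • φ (f (w, P i)) - s i • φ (f (z, P i))‖ :=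
          norm_sub_le_norm_sub_add_norm_sub _ _ _
      _ ≤ ε := by linarith
  have mem : ∀ z w, (∀ P ∈ C, ∀ i, ‖φ (f (w, P i)) - φ (f (z, P i))‖ ≤ ε / 2) →
      (∀ P ∈ C, ∀ i, ‖φ (f (-w, P i)) - φ (f (-z, P i))‖ ≤ ε / 2) → ∀ s ∈ U,
      ∀ t : Multiset E, (∀ x ∈ t, x ∈ hull (s.map (Ψ z) + s.map (Ψ w))) →
      t ∈ carried (moved f C) φ ε := by
    rintro z w h1 h2 m ⟨P, hP, P', hP', s, s', hs, hs', hm, hm'⟩ t ht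
    refine ⟨_, ⟨z, P, hP, P', hP', rfl⟩, Sum.elim s s', ?_, fun x hx => ?_⟩
    · rintro (i | i) <;> simp [hs, hs']
    · refine convexHull_min (fun y hy => ?_) (convex_convexHull ℝ _) (ht x hx)
      have hz : ∀ z, ∀ P ∈ C, ∀ i, ‖φ (f (z, P i)) - φ (f (z, P i))‖ ≤ ε / 2 := fun z P _ i => by
        rw [sub_self, norm_zero]; positivity
      rcases Multiset.mem_add.1 hy with hy | hy
      · obtain ⟨v | v, hv, rfl⟩ := Multiset.mem_map.1 hy
        · exact close z z (hz _) P hP s hs v (hm v hv) _ _ Sum.inl (fun _ => rfl) (fun _ => rfl)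
        · exact close (-z) (-z) (hz _) P' hP' s' hs' v (hm' v hv) _ _ Sum.inr (fun _ => rfl)
            (fun _ => rfl)
      · obtain ⟨v | v, hv, rfl⟩ := Multiset.mem_map.1 hy
        · exact close z w h1 P hP s hs v (hm v hv) _ _ Sum.inl (fun _ => rfl) (fun _ => rfl)
        · exact close (-z) (-w) h2 P' hP' s' hs' v (hm' v hv) _ _ Sum.inr (fun _ => rfl)
            (fun _ => rfl)
  have near : ∀ z, ∀ᶠ w in 𝓝 z, ∀ P ∈ C, ∀ i, ‖φ (f (w, P i)) - φ (f (z, P i))‖ ≤ ε / 2 := by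
    intro z
    refine hC.eventually_forall_of_forall_eventually fun P _ => eventually_all.2 fun i => ?_
    have hc : Continuous fun p : K × (ι → ℝ × ℝ) => ‖φ (f (p.1, p.2 i)) - φ (f (z, p.2 i))‖ := by
      fun_prop
    have := hc.tendsto (z, P)
    simp only [sub_self, norm_zero] at this
    exact (this.eventually (gt_mem_nhds (half_pos hε))).mono fun _ h => h.le
  have hom : ∀ z w, Homotopic τ U (carried (moved f C) φ ε) (Ψ z) (Ψ w) := by
    have : Std.Symm fun z w => Homotopic τ U (carried (moved f C) φ ε) (Ψ z) (Ψ w) :=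
      ⟨fun _ _ => Homotopic.symm⟩
    refine PreconnectedSpace.induction₂
      (fun z w => Homotopic τ U (carried (moved f C) φ ε) (Ψ z) (Ψ w)) (fun z => ?_)
      ⟨fun _ _ _ => Homotopic.trans⟩
    filter_upwards [near z, (continuous_neg.tendsto z).eventually (near (-z))] with w h1 h2
    exact homotopic_of_hull (hΨ z) (hΨ w) (mem z w h1 h2)
  obtain ⟨z⟩ := ‹Nonempty K›
  obtain ⟨D, hD1, hD, hDτ, hDU⟩ := hom z (-z)
  have hz : ∀ z, ∀ P ∈ C, ∀ i, ‖φ (f (z, P i)) - φ (f (z, P i))‖ ≤ ε / 2 := fun z P _ i => by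
    rw [sub_self, norm_zero]; positivity
  refine H.swap neg_involutive hq (fun _ => neg_mem_carried) (U := U) ?_ ?_ (hΨ z)
    (fun s hs => mem z z (hz _) (hz _) s hs _ fun x hx => mem_hull (Multiset.mem_add.2 (Or.inl hx)))
    hD1 (fun p => ?_) hDτ hDU
  · rintro m ⟨P, hP, s, hs, hm⟩
    exact ⟨P, hP, P₀, hP₀, s, 1, hs, by simp, fun v hv => hm v (by simpa using hv), by simp⟩
  · rintro m ⟨P, hP, s, hs, hm⟩ m' ⟨P', hP', s', hs', hm'⟩
    exact ⟨P, hP, P', hP', s, s', hs, hs', fun v hv => hm v (by simpa using hv),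
      fun v hv => hm' v (by simpa using hv)⟩
  · rw [hD, show Ψ (-z) = Ψ z ∘ Sum.swap by ext (v | v) <;> simp [Ψ]]

end Move

section Doubling

variable {ι κ : Type*} [Fintype ι] [Fintype κ]

lemma Null.swap {l : ι ⊕ κ → ℝ} {x : ι → ℝ} {y : κ → ℝ} (h : Null l (Sum.elim x y)) :
    Null (l ∘ Sum.swap) (Sum.elim y x) := fun u => by
  have := h u
  simp only [Fintype.sum_sum_type, Sum.elim_inl, Sum.elim_inr, Function.comp_apply, Sum.swap_inl,
    Sum.swap_inr] at this ⊢
  rw [add_comm, this]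

/-- Two clusters of points are disjoint in the first coordinate, while the second one is tiny with
respect to the first one in the second coordinate. -/
lemma eq_zero_of_window {x y : ι → ℝ} {x' y' : κ → ℝ} {r r' a a' b b' g : ℝ} (hr : 0 < r)
    (hr' : r' ≠ 0)
    (hg : ∀ l c, Null l x → (∀ u : ℝ → ℝ, (∀ w, |w - c| ≤ g → u w = 0) → ∑ i, l i * u (y i) = 0) →
      l = 0)
    (hn : ∀ l, Null l x' → Null l y' → l = 0) (hd : ∀ i j, a + r * x i ≠ a' + r' * x' j)
    (hw : ∀ j, |r' * y' j| ≤ g * r) {l : ι ⊕ κ → ℝ}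
    (h1 : Null l (Sum.elim (fun i => a + r * x i) fun j => a' + r' * x' j))
    (h2 : Null l (Sum.elim (fun i => b + r * y i) fun j => b' + r' * y' j)) : l = 0 := by
  have hl : l ∘ Sum.inl = 0 := by
    refine hg _ ((b' - b) / r) ((h1.left hd).of_affine hr.ne') fun u hu => ?_
    have := h2 fun w => u ((w - b) / r)
    simp only [Fintype.sum_sum_type, Sum.elim_inl, Sum.elim_inr, add_sub_cancel_left,
      mul_div_cancel_left₀ _ hr.ne'] at this
    rw [Finset.sum_eq_zero (s := Finset.univ (α := κ)) fun j _ => ?_, add_zero] at this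
    · exact this
    · rw [hu _ ?_, mul_zero]
      rw [← sub_div, abs_div, abs_of_pos hr, div_le_iff₀ hr,
        show b' + r' * y' j - b - (b' - b) = r' * y' j by ring]
      exact hw j
  refine eq_zero_of_inl_inr hl (hn _ ((h1.right hd).of_affine hr') ?_)
  refine Null.of_affine (a := b') hr' fun u => ?_
  have := h2 u
  have hl' : ∀ i, l (Sum.inl i) = 0 := congrFun hl
  simpa [Fintype.sum_sum_type, hl'] using this

/-- The boundary of a square. -/
abbrev SquareLoop : Type := Metric.sphere (0 : ℝ × ℝ) 1

instance : PreconnectedSpace SquareLoop :=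
  Subtype.preconnectedSpace <| isPreconnected_sphere
    (by rw [← Module.finrank_eq_rank, Module.finrank_prod]; simp) _ _

instance : Nonempty SquareLoop := ⟨⟨(1, 0), by simp⟩⟩

/-- Shrink the plane, the factor depending on `z`, and move the origin to `z`. -/
def shrink (ρ κ : ℝ) : C(SquareLoop × (ℝ × ℝ), ℝ × ℝ) where
  toFun p := p.1.1 + (ρ * (κ + max 0 (-(p.1.1.1 + p.1.1.2)))) • p.2
  continuous_toFun := by fun_prop

lemma nonresonant_shrink {P P' : ι → ℝ × ℝ} {R g κ : ℝ} (hR : 1 ≤ R)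
    (hP : ∀ i, |(P i).1| ≤ R ∧ |(P i).2| ≤ R) (hP' : ∀ i, |(P' i).1| ≤ R ∧ |(P' i).2| ≤ R)
    (hn : Nonresonant P) (hn' : Nonresonant P')
    (hg : ∀ l c, Null l (fun i => (P i).1) → (∀ u : ℝ → ℝ, (∀ w, |w - c| ≤ g → u w = 0) →
      ∑ i, l i * u (P i).2 = 0) → l = 0)
    (hg' : ∀ l c, Null l (fun i => (P i).2) → (∀ u : ℝ → ℝ, (∀ w, |w - c| ≤ g → u w = 0) →
      ∑ i, l i * u (P i).1 = 0) → l = 0)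
    (hκ : 0 < κ) (hκ1 : κ ≤ 1) (hκg : 2 * κ * R ≤ g) (z : SquareLoop)
    (hz : z.1.1 + z.1.2 ≤ 0) :
    Nonresonant (Sum.elim (fun i => shrink (40 * R)⁻¹ κ (z, P i))
      fun i => shrink (40 * R)⁻¹ κ (-z, P' i)) := by
  obtain ⟨⟨a, b⟩, hab⟩ := z
  simp only at hz
  intro l h1 h2
  set ρ := (40 * R)⁻¹
  have hρ : 0 < ρ := by positivity
  have hρR : ρ * R = 1 / 40 := by simp only [ρ]; field_simp
  set r := ρ * (κ - (a + b))
  set r' := ρ * κ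
  have hr : 0 < r := mul_pos hρ (by linarith)
  have hr' : 0 < r' := mul_pos hρ hκ
  have hab : max |a| |b| = 1 := by simpa [Prod.norm_def] using hab
  have ha := abs_le.1 ((le_max_left _ _).trans hab.le)
  have hb := abs_le.1 ((le_max_right _ _).trans hab.le)
  have small : ∀ t, |t| ≤ R → |r * t| ≤ 3 / 40 := fun t ht => by
    rw [abs_mul, abs_of_pos hr]
    calc r * |t| ≤ (ρ * 3) * R := by
          gcongr
          simp only [r]; gcongr; linarith
      _ = 3 / 40 := by linear_combination 3 * hρR
  have small' : ∀ t, |t| ≤ R → |r' * t| ≤ 1 / 40 := fun t ht => by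
    rw [abs_mul, abs_of_pos hr']
    calc r' * |t| ≤ (ρ * 1) * R := by gcongr; simp only [r']; gcongr
      _ = 1 / 40 := by linear_combination hρR
  have tiny : 9 / 10 ≤ -(a + b) → ∀ t, |t| ≤ R → |r' * t| ≤ g * r := fun h t ht => by
    have hg0 : 0 < g := lt_of_lt_of_le (by positivity) hκg
    rw [abs_mul, abs_of_pos hr']
    calc r' * |t| ≤ ρ * (κ * R) := by rw [← mul_assoc]; gcongr
      _ ≤ ρ * (g * (9 / 10)) := mul_le_mul_of_nonneg_left (by linarith) hρ.le
      _ ≤ ρ * (g * (κ - (a + b))) := by gcongr; linarith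
      _ = g * r := by simp only [r]; ring
  have sep : ∀ c, 1 / 10 < |c| → ∀ s t, |s| ≤ R → |t| ≤ R → c + r * s ≠ -c + r' * t :=
    fun c hc s t hs ht h => by
      have h3 := abs_le.1 (small s hs)
      have h4 := abs_le.1 (small' t ht)
      rcases lt_abs.1 hc with hc | hc <;> linarith
  have e1 : ∀ p, shrink ρ κ (⟨(a, b), by simpa [Prod.norm_def]⟩, p) =
      (a + r * p.1, b + r * p.2) := fun p => by
    have h : max 0 (-(a + b)) = -(a + b) := max_eq_right (by linarith)
    ext <;> simp only [shrink, ContinuousMap.coe_mk, h, Prod.fst_add, Prod.snd_add, Prod.smul_fst,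
      Prod.smul_snd, smul_eq_mul, r] <;> ring
  have e2 : ∀ p, shrink ρ κ (-⟨(a, b), by simpa [Prod.norm_def]⟩, p) =
      (-a + r' * p.1, -b + r' * p.2) := fun p => by
    have h : max 0 (-(-a + -b)) = 0 := max_eq_left (by linarith)
    ext <;> simp only [shrink, ContinuousMap.coe_mk, coe_neg_sphere, Prod.neg_mk, h,
      Prod.fst_add, Prod.snd_add, Prod.smul_fst, Prod.smul_snd, smul_eq_mul, r', add_zero]
  replace h1 : Null l (Sum.elim (fun i => a + r * (P i).1) fun i => -a + r' * (P' i).1) := by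
    convert h1 using 1
    ext (i | i)
    · simp only [Sum.elim_inl, e1]
    · simp only [Sum.elim_inr, e2]
  replace h2 : Null l (Sum.elim (fun i => b + r * (P i).2) fun i => -b + r' * (P' i).2) := by
    convert h2 using 1
    ext (i | i)
    · simp only [Sum.elim_inl, e1]
    · simp only [Sum.elim_inr, e2]
  have d1 : 1 / 10 < |a| → ∀ i j, a + r * (P i).1 ≠ -a + r' * (P' j).1 := fun h i j =>
    sep a h _ _ (hP i).1 (hP' j).1
  have d2 : 1 / 10 < |b| → ∀ i j, b + r * (P i).2 ≠ -b + r' * (P' j).2 := fun h i j =>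
    sep b h _ _ (hP i).2 (hP' j).2
  by_cases ha1 : 1 / 10 < |a|
  · by_cases hb1 : 1 / 10 < |b|
    · exact eq_zero_of_inl_inr
        (hn _ (((h1.left (d1 ha1))).of_affine hr.ne') ((h2.left (d2 hb1)).of_affine hr.ne'))
        (hn' _ (((h1.right (d1 ha1))).of_affine hr'.ne') ((h2.right (d2 hb1)).of_affine hr'.ne'))
    · have h3 := abs_le.1 (not_lt.1 hb1)
      have h4 : 1 ≤ |a| := by
        by_contra h; exact (max_lt (not_le.1 h) (by linarith)).ne hab
      have h5 : 9 / 10 ≤ -(a + b) := by rcases le_abs.1 h4 with h | h <;> linarith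
      exact eq_zero_of_window hr hr'.ne' hg hn' (d1 ha1) (fun j => tiny h5 _ (hP' j).2) h1 h2
  · have h3 := abs_le.1 (not_lt.1 ha1)
    have h4 : 1 ≤ |b| := by
      by_contra h; exact (max_lt (by linarith) (not_le.1 h)).ne hab
    have h5 : 9 / 10 ≤ -(a + b) := by rcases le_abs.1 h4 with h | h <;> linarith
    exact eq_zero_of_window hr hr'.ne' hg' (fun l h h' => hn' l h' h) (d2 (by linarith))
      (fun j => tiny h5 _ (hP' j).1) h2 h1

lemma Flexible.double {q : ℕ} (H : Flexible ι q) (hq : Even q) : Flexible (ι ⊕ ι) (2 * q + 2) := by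
  obtain ⟨C, hC, hn, hh⟩ := H
  obtain ⟨R, hR1, hR⟩ := exists_coord_bound hC
  obtain ⟨g₁, hg₁, G₁⟩ := exists_gap hC (x := fun P i => (P i).1) (y := fun P i => (P i).2)
    (by fun_prop) (by fun_prop) hn
  obtain ⟨g₂, hg₂, G₂⟩ := exists_gap hC (x := fun P i => (P i).2) (y := fun P i => (P i).1)
    (by fun_prop) (by fun_prop) fun P hP l h h' => hn P hP l h' h
  set g := min g₁ g₂
  have hg : 0 < g := lt_min hg₁ hg₂
  set κ := min 1 (g / (2 * R))
  have hκ : 0 < κ := lt_min one_pos (by positivity)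
  have hκg : 2 * κ * R ≤ g := by
    have := (le_div_iff₀ (by positivity)).1 (min_le_right 1 (g / (2 * R)))
    linarith
  refine ⟨moved (shrink (40 * R)⁻¹ κ) C, isCompact_moved _ hC, ?_, fun E _ _ φ ε hε =>
    hasHemispheres_moved hC hq hh _ E φ hε⟩
  have key : ∀ z : SquareLoop, z.1.1 + z.1.2 ≤ 0 → ∀ P ∈ C, ∀ P' ∈ C,
      Nonresonant (Sum.elim (fun i => shrink (40 * R)⁻¹ κ (z, P i))
        fun i => shrink (40 * R)⁻¹ κ (-z, P' i)) := fun z hz P hP P' hP' =>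
    nonresonant_shrink hR1 (hR P hP) (hR P' hP') (hn P hP) (hn P' hP')
      (fun l c h h' => G₁ P hP l c h fun u hu =>
        h' u fun w hw => hu w (hw.trans (min_le_left _ _)))
      (fun l c h h' => G₂ P hP l c h fun u hu =>
        h' u fun w hw => hu w (hw.trans (min_le_right _ _)))
      hκ (min_le_left _ _) hκg z hz
  rintro _ ⟨z, P, hP, P', hP', rfl⟩
  rcases le_total (z.1.1 + z.1.2) 0 with hz | hz
  · exact key z hz P hP P' hP'
  · intro l h1 h2
    have := key (-z) (by simp; linarith) P' hP' P hP (l ∘ Sum.swap) ?_ ?_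
    · ext i
      simpa using congrFun this i.swap
    · convert Null.swap (x := fun i => (shrink (40 * R)⁻¹ κ (z, P i)).1)
        (y := fun i => (shrink (40 * R)⁻¹ κ (-z, P' i)).1) ?_ using 1
      · ext (i | i) <;> simp
      · convert h1 using 1
        ext (i | i) <;> simp
    · convert Null.swap (x := fun i => (shrink (40 * R)⁻¹ κ (z, P i)).2)
        (y := fun i => (shrink (40 * R)⁻¹ κ (-z, P' i)).2) ?_ using 1
      · ext (i | i) <;> simp
      · convert h2 using 1
        ext (i | i) <;> simp

end Doubling

lemma flexible_two_pow (k : ℕ) : ∃ q, q + 2 = 2 * 2 ^ k ∧ Flexible (Fin (2 ^ k)) q := by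
  induction k with
  | zero => exact ⟨0, rfl, flexible_unit.congr (finCongr (by simp)|>.trans finOneEquiv).symm⟩
  | succ k ih =>
    obtain ⟨q, hq, h⟩ := ih
    refine ⟨2 * q + 2, by rw [pow_succ]; omega, ?_⟩
    have he : Even q := (Nat.even_add.1 (hq ▸ even_two_mul _)).2 even_two
    exact (h.double he).congr (finSumFinEquiv.trans (finCongr (by ring)))

lemma flexible_mul_two_pow {n : ℕ} (hn : n ≠ 0) (k : ℕ) :
    ∃ q, q + (Nat.digits 2 n).sum + 1 = 2 * (n * 2 ^ k) ∧ Flexible (Fin (n * 2 ^ k)) q := by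
  induction n using Nat.strong_induction_on generalizing k with
  | _ n ih =>
    have hd : (Nat.digits 2 n).sum = n % 2 + (Nat.digits 2 (n / 2)).sum := by
      rw [Nat.digits_def' one_lt_two (Nat.pos_of_ne_zero hn), List.sum_cons]
    rcases Nat.eq_zero_or_pos (n / 2) with h0 | h0
    · obtain rfl : n = 1 := by omega
      obtain ⟨q, hq, h⟩ := flexible_two_pow k
      exact ⟨q, by simp [← hq], h.congr (finCongr (one_mul _).symm)⟩
    · obtain ⟨q, hq, h⟩ := ih (n / 2) (by omega) h0.ne' (k + 1)
      rcases Nat.mod_two_eq_zero_or_one n with h1 | h1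
      · have e : n / 2 * 2 ^ (k + 1) = n * 2 ^ k := by
          rw [pow_succ', ← mul_assoc]; congr 1; omega
        exact ⟨q, by rw [hd, h1, zero_add, hq, e], h.congr (finCongr e)⟩
      · have e : n / 2 * 2 ^ (k + 1) + 2 ^ k = n * 2 ^ k := by
          rw [pow_succ', ← mul_assoc, ← Nat.succ_mul]; congr 1; omega
        obtain ⟨q', hq', h'⟩ := flexible_two_pow k
        exact ⟨q + q' + 1, by omega, (h.join h').congr (finSumFinEquiv.trans (finCongr e))⟩

lemma exists_flexible_fin {n : ℕ} (hn : n ≠ 0) :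
    ∃ q, q + (Nat.digits 2 n).sum + 1 = 2 * n ∧ Flexible (Fin n) q := by
  obtain ⟨q, hq, h⟩ := flexible_mul_two_pow hn 0
  exact ⟨q, by simpa using hq, h.congr (finCongr (by simp))⟩

section Dependent

variable {ι : Type*} [Fintype ι] {E : Type*} [NormedAddCommGroup E] [NormedSpace ℝ E]

open Pointwise in
lemma exists_of_mem_tube {φ : ℝ × ℝ → E} {P : ι → ℝ × ℝ} {s : ι → ℝ} (hs : ∀ i, |s i| = 1)
    {ε : ℝ} {v : E} (hv : v ∈ tube φ P s ε) :
    ∃ l : ι → ℝ, ∑ i, |l i| = 1 ∧ ‖v - ∑ i, l i • φ (P i)‖ ≤ ε := by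
  classical
  let A : (ι → ℝ) →ₗ[ℝ] E := Fintype.linearCombination ℝ fun i => s i • φ (P i)
  have hT : v ∈ A '' stdSimplex ℝ ι + Metric.closedBall (0 : E) ε := by
    refine convexHull_min (fun v hv => ?_)
      (((convex_stdSimplex ℝ ι).linear_image A).add (convex_closedBall 0 ε)) hv
    obtain ⟨i, hi⟩ := hv
    refine Set.mem_add.2 ⟨s i • φ (P i), ⟨Pi.single i 1, single_mem_stdSimplex ℝ i, ?_⟩, _,
      mem_closedBall_zero_iff.2 hi, by abel⟩
    simp [A, Fintype.linearCombination_apply, Pi.single_apply]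
  obtain ⟨_, ⟨w, ⟨hw, hw1⟩, rfl⟩, x, hx, rfl⟩ := Set.mem_add.1 hT
  refine ⟨fun i => w i * s i, ?_, ?_⟩
  · rw [← hw1]
    exact Finset.sum_congr rfl fun i _ => by rw [abs_mul, hs, mul_one, abs_of_nonneg (hw i)]
  · simpa [A, Fintype.linearCombination_apply, mul_smul] using hx

lemma Flexible.exists_dependent {q N : ℕ} (H : Flexible ι q) (hN : N ≤ q)
    (φ : ℝ → C(ℝ × ℝ, Fin N → ℝ)) :
    ∃ R, ∃ P : ι → ℝ × ℝ, (∀ i, |(P i).1| ≤ R ∧ |(P i).2| ≤ R) ∧ Nonresonant P ∧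
      ∃ l : ι → ℝ, l ≠ 0 ∧ ∑ i, l i • φ R (P i) = 0 := by
  obtain ⟨C, hC, hn, hh⟩ := H
  obtain ⟨R, -, hR⟩ := exists_coord_bound hC
  suffices h : ∃ P ∈ C, ∃ l : ι → ℝ, l ≠ 0 ∧ ∑ i, l i • φ R (P i) = 0 by
    obtain ⟨P, hP, h⟩ := h
    exact ⟨R, P, hR P hP, hn P hP, h⟩
  by_contra! hc
  have hS : IsCompact {l : ι → ℝ | ∑ i, |l i| = 1} := by
    refine (isCompact_closedBall 0 1).of_isClosed_subset
      (isClosed_eq (by fun_prop) continuous_const) fun l hl => ?_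
    rw [mem_closedBall_zero_iff, pi_norm_le_iff_of_nonneg zero_le_one]
    exact fun i => (Finset.single_le_sum (f := fun i => |l i|) (fun i _ => abs_nonneg _)
      (Finset.mem_univ i)).trans hl.le
  obtain ⟨δ, hδ, h⟩ := (hC.prod hS).exists_forall_le' (a := (0 : ℝ))
    (f := fun p : (ι → ℝ × ℝ) × (ι → ℝ) => ‖∑ i, p.2 i • φ R (p.1 i)‖) (by fun_prop)
    fun p hp => norm_pos_iff.2 <| hc p.1 hp.1 p.2 fun h0 => by simpa [h0] using hp.2
  obtain ⟨B, hB⟩ := hC.exists_bound_of_continuousOn (f := fun P i => φ R (P i)) (by fun_prop)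
  refine not_hasHemispheres_away (D := 2 * (B + δ / 2)) (half_pos hδ) hN
    ((hh _ (φ R) (δ / 2) (half_pos hδ)).map id (by simp) ?_)
  rintro m ⟨P, hP, s, hs, hm⟩
  have hb : ∀ v ∈ m, ‖v‖ ≤ B + δ / 2 := fun v hv => by
    rw [← mem_closedBall_zero_iff]
    refine convexHull_min ?_ (convex_closedBall 0 _) (hm v hv)
    rintro v ⟨i, hi⟩
    have h1 : ‖s i • φ R (P i)‖ ≤ B := by
      rw [norm_smul, Real.norm_eq_abs, hs, one_mul]
      exact (norm_le_pi_norm (fun i => φ R (P i)) i).trans (hB P hP)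
    rw [mem_closedBall_zero_iff]
    linarith [norm_le_norm_add_norm_sub' v (s i • φ R (P i))]
  rw [Multiset.map_id]
  refine ⟨fun x hx => ?_, fun x hx y hy => ?_⟩
  · obtain ⟨l, hl, hx⟩ := exists_of_mem_tube hs (convexHull_min hm (convex_convexHull ℝ _) hx)
    have := h (P, l) ⟨hP, hl⟩
    simp only at this
    linarith [norm_le_norm_add_norm_sub' (∑ i, l i • φ R (P i)) x,
      norm_sub_rev x (∑ i, l i • φ R (P i))]
  · linarith [norm_sub_le x y, hb x hx, hb y hy]

end Dependent

section Chords

variable {ι : Type*} [Fintype ι]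

lemma null_of_continuous {l x : ι → ℝ} {A : Set ℝ} (hA : IsClosed A)
    (h : ∀ u : C(ℝ, ℝ), (∀ t ∈ A, u t = 0) → ∑ i, l i * u (x i) = 0) (hx : ∀ i, x i ∉ A) :
    Null l x := null_of_fiber fun c => by
  by_cases hc : ∃ i, x i = c
  · obtain ⟨k, rfl⟩ := hc
    obtain ⟨u, hu0, hu1, -⟩ := exists_continuous_zero_one_of_isClosed
      (hA.union ((Set.finite_range x).subset Set.sdiff_subset).isClosed :
        IsClosed (A ∪ (Set.range x \ {x k}))) (isClosed_singleton (x := x k))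
      (by simp [hx k])
    refine Eq.trans ?_ (h u fun t ht => hu0 (Or.inl ht))
    refine Finset.sum_congr rfl fun i _ => ?_
    split_ifs with hi
    · rw [hi, hu1 rfl]; rfl
    · rw [hu0 (Or.inr ⟨⟨i, rfl⟩, hi⟩)]; rfl
  · exact Finset.sum_eq_zero fun i _ => by rw [if_neg fun hi => hc ⟨i, hi⟩, mul_zero]

lemma Nonresonant.linearIndependent {P : ι → ℝ × ℝ} (hP : Nonresonant P) {L m : ℝ}
    (h1 : ∀ i, (P i).1 < m) (h2 : ∀ i, m < (P i).2 + L) :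
    LinearIndependent ℝ fun i => evalDiff (P i).1 ((P i).2 + L) := by
  rw [Fintype.linearIndependent_iff]
  intro l hl
  have key : ∀ u : C(ℝ, ℝ), ∑ i, l i * u ((P i).2 + L) - ∑ i, l i * u (P i).1 = 0 := fun u => by
    have := LinearMap.congr_fun hl u
    simpa [LinearMap.sum_apply, evalDiff, mul_sub, Finset.sum_sub_distrib] using this
  refine congrFun (hP l (null_of_continuous (A := Set.Ici m) isClosed_Ici (fun u hu => ?_)
    fun i => not_le.2 (h1 i)) ?_)
  · have := key u
    rwa [Finset.sum_eq_zero (f := fun i => l i * u ((P i).2 + L)) fun i _ => by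
      rw [hu _ (h2 i).le, mul_zero], zero_sub, neg_eq_zero] at this
  · refine Null.of_affine (a := L) one_ne_zero (null_of_continuous (A := Set.Iic m) isClosed_Iic
      (fun u hu => ?_) fun i => ?_)
    · have := key u
      rw [Finset.sum_eq_zero (f := fun i => l i * u (P i).1) fun i _ => by
        rw [hu _ (h1 i).le, mul_zero], sub_zero] at this
      simpa [add_comm] using this
    · rw [Set.mem_Iic, not_le, one_mul, add_comm]
      exact h2 i

/-- A linear relation between functionals on a finite dimensional space increases the dimension of
their common kernel. -/
lemma finrank_sub_card_lt_of_relation {V : Type*} [AddCommGroup V] [Module ℝ V]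
    (F : Submodule ℝ V) [FiniteDimensional ℝ F] (g : ι → V →ₗ[ℝ] ℝ) {l : ι → ℝ} (hl : l ≠ 0)
    (h : ∀ v ∈ F, ∑ i, l i * g i v = 0) :
    (Module.finrank ℝ F : ℤ) - Fintype.card ι <
      Module.finrank ℝ ↥(F ⊓ ⨅ i, LinearMap.ker (g i)) := by
  let T : F →ₗ[ℝ] ι → ℝ := (LinearMap.pi g).comp F.subtype
  have hk : Module.finrank ℝ ↥(F ⊓ ⨅ i, LinearMap.ker (g i)) =
      Module.finrank ℝ (LinearMap.ker T) := by
    rw [← LinearMap.ker_pi, LinearMap.ker_comp, ← Submodule.map_comap_subtype]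
    exact Submodule.finrank_map_subtype_eq _ _
  have hr : Module.finrank ℝ (LinearMap.range T) < Fintype.card ι := by
    rw [← Module.finrank_fintype_fun_eq_card ℝ]
    refine Submodule.finrank_lt fun htop => hl ?_
    ext i
    classical
    obtain ⟨v, hv⟩ := LinearMap.range_eq_top.1 htop (Pi.single i 1)
    have := h v v.2
    have hv' : ∀ j, g j v = (Pi.single i 1 : ι → ℝ) j := fun j => congrFun hv j
    simpa [hv', Pi.single_apply] using this
  have := T.finrank_range_add_finrank_ker
  omega

end Chords

end ChordChains

/-- If `N < 2n - I(n)`, where `I(n) = (Nat.digits 2 n).sum` is the number of ones in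
the binary expansion of `n`, then for every `N`-dimensional subspace `F` of `C(ℝ, ℝ)`
there is a non-resonant `n`-chord diagram `(a_i, b_i)` such that the subspace
`{f ∈ F : f (a i) = f (b i) for all i}` has dimension strictly greater than `N - n`. -/
theorem stmt1 (n N : ℕ) (hn : 1 ≤ n) (hN : N < 2 * n - (Nat.digits 2 n).sum)
    (F : Submodule ℝ C(ℝ, ℝ)) [FiniteDimensional ℝ F]
    (hF : Module.finrank ℝ F = N) :
    ∃ a b : Fin n → ℝ,
      (∀ i, a i < b i) ∧
      Function.Injective (fun i => (a i, b i)) ∧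
      LinearIndependent ℝ (fun i => evalDiff (a i) (b i)) ∧
      (N : ℤ) - n <
        Module.finrank ℝ ↥(F ⊓ ⨅ i, LinearMap.ker (evalDiff (a i) (b i))) := by
  obtain ⟨q, hq, H⟩ := ChordChains.exists_flexible_fin (Nat.one_le_iff_ne_zero.1 hn)
  let B : Module.Basis (Fin N) ℝ F := Module.finBasisOfFinrankEq ℝ F hF
  let φ : ℝ → C(ℝ × ℝ, Fin N → ℝ) := fun R =>
    ⟨fun p j => (B j : C(ℝ, ℝ)) (p.2 + (2 * R + 2)) - (B j : C(ℝ, ℝ)) p.1, by fun_prop⟩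
  obtain ⟨R, P, hR, hP, l, hl, h⟩ := H.exists_dependent (show N ≤ q by omega) φ
  have h1 : ∀ i, (P i).1 < R + 1 := fun i => by linarith [(abs_le.1 (hR i).1).2]
  have h2 : ∀ i, R + 1 < (P i).2 + (2 * R + 2) := fun i => by linarith [(abs_le.1 (hR i).2).1]
  have hli := hP.linearIndependent h1 h2
  refine ⟨fun i => (P i).1, fun i => (P i).2 + (2 * R + 2), fun i => (h1 i).trans (h2 i),
    fun i j hij => hli.injective ?_, hli, ?_⟩
  · simp only [Prod.mk.injEq] at hij
    simp only [hij]
  · have := ChordChains.finrank_sub_card_lt_of_relation F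
      (fun i => evalDiff (P i).1 ((P i).2 + (2 * R + 2))) hl fun v hv => ?_
    · rwa [hF, Fintype.card_fin] at this
    · let Λ : C(ℝ, ℝ) →ₗ[ℝ] ℝ := ∑ i, l i • evalDiff (P i).1 ((P i).2 + (2 * R + 2))
      have hΛ : Λ.comp F.subtype = 0 := B.ext fun j => by
        simpa [Λ, φ, evalDiff] using congrFun h j
      simpa [Λ] using LinearMap.congr_fun hΛ ⟨v, hv⟩
end
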